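/- arXiv:1310.7643 — 13 statements merged into one kernel-verified Lean document; each statement's English description precedes it below -/
import Mathlib

section
/- For all t > 0 and all x, y ∈ ℝ, the physical skew diffusion transition density is symmetric: p*(t,x,y) = p*(t,y,x). -/
open MeasureTheory Real Filter Topology

/-- The physical skew diffusion transition density with dispersion
coefficients `Dp = D⁺` (for `x > 0`) and `Dm = D⁻` (for `x ≤ 0`). -/
noncomputable def pStar (Dp Dm t x y : ℝ) : ℝ :=
  if 0 < x ∧ 0 < y then
    (Real.sqrt (2 * Real.pi * Dp * t))⁻¹ *
      (Real.exp (-(y - x) ^ 2 / (2 * Dp * t)) +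
        ((Real.sqrt Dp - Real.sqrt Dm) / (Real.sqrt Dp + Real.sqrt Dm)) *
          Real.exp (-(y + x) ^ 2 / (2 * Dp * t)))
  else if x < 0 ∧ y ≤ 0 then
    (Real.sqrt (2 * Real.pi * Dm * t))⁻¹ *
      (Real.exp (-(y - x) ^ 2 / (2 * Dm * t)) -
        ((Real.sqrt Dp - Real.sqrt Dm) / (Real.sqrt Dp + Real.sqrt Dm)) *
          Real.exp (-(y + x) ^ 2 / (2 * Dm * t)))
  else if x ≤ 0 ∧ 0 < y then
    (2 / (Real.sqrt Dp + Real.sqrt Dm)) * (Real.sqrt (2 * Real.pi * t))⁻¹ *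
      Real.exp (-(y * Real.sqrt Dm - x * Real.sqrt Dp) ^ 2 / (2 * Dp * Dm * t))
  else
    (2 / (Real.sqrt Dp + Real.sqrt Dm)) * (Real.sqrt (2 * Real.pi * t))⁻¹ *
      Real.exp (-(y * Real.sqrt Dp - x * Real.sqrt Dm) ^ 2 / (2 * Dp * Dm * t))

/-- The boundary case `x = 0`, `y < 0`, where two different branches must agree. -/
theorem pStar_zero_left_neg (Dp Dm : ℝ) (hDp : 0 < Dp) (hDm : 0 < Dm)
    (t : ℝ) (ht : 0 < t) (y : ℝ) (hy : y < 0) :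
    pStar Dp Dm t 0 y = pStar Dp Dm t y 0 := by
  have ha : 0 < Real.sqrt Dp := Real.sqrt_pos.2 hDp
  have hb : 0 < Real.sqrt Dm := Real.sqrt_pos.2 hDm
  have hc : 0 < Real.sqrt (2 * Real.pi * t) := Real.sqrt_pos.2 (by positivity)
  have hs : Real.sqrt (2 * Real.pi * Dm * t) = Real.sqrt Dm * Real.sqrt (2 * Real.pi * t) := by
    rw [← Real.sqrt_mul hDm.le]
    congr 1
    ring
  have e1 : -(y * Real.sqrt Dp - 0 * Real.sqrt Dm) ^ 2 / (2 * Dp * Dm * t)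
      = -y ^ 2 / (2 * Dm * t) := by
    rw [zero_mul, sub_zero, mul_pow, Real.sq_sqrt hDp.le]
    field_simp
  have h1 : ¬ (0 < y) := not_lt.2 hy.le
  have e2 : -(0 - y) ^ 2 / (2 * Dm * t) = -y ^ 2 / (2 * Dm * t) := by ring
  have e3 : -(0 + y) ^ 2 / (2 * Dm * t) = -y ^ 2 / (2 * Dm * t) := by ring
  unfold pStar
  rw [if_neg (fun h => h1 h.2), if_neg (fun h => lt_irrefl _ h.1), if_neg (fun h => h1 h.2),
    if_neg (fun h => h1 h.1), if_pos ⟨hy, le_refl _⟩, e1, e2, e3, hs]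
  generalize Real.exp (-y ^ 2 / (2 * Dm * t)) = E
  field_simp
  ring

/-- the physical skew diffusion transition density is symmetric
in the backward and forward variables. -/
theorem pStar_symm (Dp Dm : ℝ) (hDp : 0 < Dp) (hDm : 0 < Dm)
    (t : ℝ) (ht : 0 < t) (x y : ℝ) :
    pStar Dp Dm t x y = pStar Dp Dm t y x := by
  rcases lt_trichotomy x 0 with hx | rfl | hx
  · rcases lt_trichotomy y 0 with hy | rfl | hy
    · simp only [pStar, hx, hy, hx.le, hy.le, not_lt.2 hx.le, not_lt.2 hy.le, and_self, if_true,
        if_false]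
      rw [add_comm y x, sub_sq_comm y x]
    · exact (pStar_zero_left_neg Dp Dm hDp hDm t ht x hx).symm
    · simp only [pStar, hx, hy, hx.le, not_lt.2 hx.le, not_lt.2 hy.le, not_le.2 hy, and_true,
        and_false, and_self, if_true, if_false]
      rw [sub_sq_comm]
  · rcases lt_trichotomy y 0 with hy | rfl | hy
    · exact pStar_zero_left_neg Dp Dm hDp hDm t ht y hy
    · rfl
    · simp only [pStar, hy, le_refl, lt_irrefl, not_lt.2 hy.le, not_le.2 hy, and_true,
        and_false, and_self, if_true, if_false]
      rw [sub_sq_comm]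
  · rcases lt_or_ge 0 y with hy | hy
    · simp only [pStar, hx, hy, and_self, if_true]
      rw [add_comm y x, sub_sq_comm y x]
    · simp only [pStar, hx, hy, not_lt.2 hx.le, not_lt.2 hy, not_le.2 hx, and_true,
        and_false, and_self, if_true, if_false]
      rw [sub_sq_comm]
end

section
/- Fix x ∈ ℝ. The function (t,y) ↦ p*(t,x,y) is a solution of the interface heat problem in the forward variable: (i) for every t > 0 and every y ≠ 0, ∂p*/∂t (t,x,y) = (1/2)·D(y)·∂²p*/∂y² (t,x,y); (ii) for every t > 0, lim_{y↓0} p*(t,x,y) = lim_{y↑0} p*(t,x,y) (continuity across the interface); (iii) for every t > 0, D⁺·lim_{y↓0} ∂p*/∂y (t,x,y) = D⁻·lim_{y↑0} ∂p*/∂y (t,x,y) (continuity of the diffusive flux across the interface). -/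
open MeasureTheory Real Filter Topology

/-- One Gaussian building block. -/
noncomputable def gK (D t u : ℝ) : ℝ := (Real.sqrt t)⁻¹ * Real.exp (-u ^ 2 / (2 * D * t))

/-- Superposition of two shifted Gaussians. -/
noncomputable def FK (D A a B b t y : ℝ) : ℝ := A * gK D t (y - a) + B * gK D t (y - b)

/-- Its space derivative. -/
noncomputable def FK1 (D A a B b t y : ℝ) : ℝ :=
  A * (-(y - a) / (D * t) * gK D t (y - a)) + B * (-(y - b) / (D * t) * gK D t (y - b))

/-- Its time derivative. -/
noncomputable def FKt (D A a B b t y : ℝ) : ℝ :=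
  A * (((y - a) ^ 2 / (2 * D * t ^ 2) - 1 / (2 * t)) * gK D t (y - a))
    + B * (((y - b) ^ 2 / (2 * D * t ^ 2) - 1 / (2 * t)) * gK D t (y - b))

lemma gK_y (D t a y : ℝ) (hD : 0 < D) (ht : 0 < t) :
    HasDerivAt (fun z => gK D t (z - a)) (-(y - a) / (D * t) * gK D t (y - a)) y := by
  unfold gK
  have h := (((((hasDerivAt_id y).sub_const a).pow 2).neg.div_const (2 * D * t)).exp).const_mul
    (Real.sqrt t)⁻¹
  refine (h.congr_deriv ?_)
  simp
  field_simp
  ring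

lemma gK_t (D t u : ℝ) (hD : 0 < D) (ht : 0 < t) :
    HasDerivAt (fun s => gK D s u) ((u ^ 2 / (2 * D * t ^ 2) - 1 / (2 * t)) * gK D t u) t := by
  unfold gK
  have hs : Real.sqrt t ≠ 0 := (Real.sqrt_pos.2 ht).ne'
  have hss : Real.sqrt t ^ 2 = t := Real.sq_sqrt ht.le
  have h1 := (Real.hasDerivAt_sqrt ht.ne').inv hs
  have h2 := (((hasDerivAt_const t (-u ^ 2)).div ((hasDerivAt_id t).const_mul (2 * D))
    (by simp; exact ⟨hD.ne', ht.ne'⟩))).exp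
  refine ((h1.mul h2).congr_deriv ?_)
  simp only [id, Pi.div_apply, Pi.inv_apply]
  rw [hss]
  field_simp
  ring

lemma FK_y (D A a B b t y : ℝ) (hD : 0 < D) (ht : 0 < t) :
    HasDerivAt (fun z => FK D A a B b t z) (FK1 D A a B b t y) y :=
  ((gK_y D t a y hD ht).const_mul A).add ((gK_y D t b y hD ht).const_mul B)

lemma FK_t (D A a B b t y : ℝ) (hD : 0 < D) (ht : 0 < t) :
    HasDerivAt (fun s => FK D A a B b s y) (FKt D A a B b t y) t :=
  ((gK_t D t (y - a) hD ht).const_mul A).add ((gK_t D t (y - b) hD ht).const_mul B)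

lemma gK_yy (D t a y : ℝ) (hD : 0 < D) (ht : 0 < t) :
    HasDerivAt (fun z => -(z - a) / (D * t) * gK D t (z - a))
      (2 / D * (((y - a) ^ 2 / (2 * D * t ^ 2) - 1 / (2 * t)) * gK D t (y - a))) y := by
  have h := ((((hasDerivAt_id y).sub_const a).neg.div_const (D * t))).mul (gK_y D t a y hD ht)
  refine h.congr_deriv ?_
  simp
  field_simp
  ring

lemma FK_yy (D A a B b t y : ℝ) (hD : 0 < D) (ht : 0 < t) :
    HasDerivAt (fun z => FK1 D A a B b t z) (2 / D * FKt D A a B b t y) y := by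
  have h := ((gK_yy D t a y hD ht).const_mul A).add ((gK_yy D t b y hD ht).const_mul B)
  refine h.congr_deriv ?_
  unfold FKt
  ring

/-- Interior heat equation for any function agreeing with `FK` on an open set. -/
lemma heat_of_rep (q : ℝ → ℝ → ℝ) (S : Set ℝ) (hS : IsOpen S) (D A a B b : ℝ) (hD : 0 < D)
    (h : ∀ t, 0 < t → ∀ y ∈ S, q t y = FK D A a B b t y) (t : ℝ) (ht : 0 < t) (y : ℝ)
    (hy : y ∈ S) :
    deriv (fun s => q s y) t = (1 / 2) * D * deriv (deriv (fun z => q t z)) y := by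
  have e1 : (fun s => q s y) =ᶠ[𝓝 t] fun s => FK D A a B b s y := by
    filter_upwards [lt_mem_nhds ht] with s hs using h s hs y hy
  have e2 : ∀ z ∈ S, deriv (fun z => q t z) z = FK1 D A a B b t z := by
    intro z hz
    have : (fun z => q t z) =ᶠ[𝓝 z] fun z => FK D A a B b t z := by
      filter_upwards [hS.mem_nhds hz] with w hw using h t ht w hw
    rw [this.deriv_eq, (FK_y D A a B b t z hD ht).deriv]
  have e3 : deriv (fun z => q t z) =ᶠ[𝓝 y] fun z => FK1 D A a B b t z := by
    filter_upwards [hS.mem_nhds hy] with w hw using e2 w hw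
  rw [e1.deriv_eq, e3.deriv_eq, (FK_t D A a B b t y hD ht).deriv, (FK_yy D A a B b t y hD ht).deriv]
  field_simp

lemma lim_of_rep (q : ℝ → ℝ) (S : Set ℝ) (hS : IsOpen S) (D A a B b t : ℝ) (hD : 0 < D)
    (ht : 0 < t) (h : ∀ y ∈ S, q y = FK D A a B b t y) :
    Tendsto q (𝓝[S] 0) (𝓝 (FK D A a B b t 0)) ∧
    Tendsto (deriv q) (𝓝[S] 0) (𝓝 (FK1 D A a B b t 0)) := by
  have e2 : ∀ z ∈ S, deriv q z = FK1 D A a B b t z := by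
    intro z hz
    have : q =ᶠ[𝓝 z] fun z => FK D A a B b t z := by
      filter_upwards [hS.mem_nhds hz] with w hw using h w hw
    rw [this.deriv_eq, (FK_y D A a B b t z hD ht).deriv]
  constructor
  · refine Tendsto.congr' ?_ ((FK_y D A a B b t 0 hD ht).continuousAt.tendsto.mono_left
      nhdsWithin_le_nhds)
    filter_upwards [self_mem_nhdsWithin] with z hz using (h z hz).symm
  · refine Tendsto.congr' ?_ ((FK_yy D A a B b t 0 hD ht).continuousAt.tendsto.mono_left
      nhdsWithin_le_nhds)
    filter_upwards [self_mem_nhdsWithin] with z hz using (e2 z hz).symm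

lemma rep (Dp Dm : ℝ) (hDp : 0 < Dp) (hDm : 0 < Dm) (x : ℝ) :
    ∃ A a B b A' a' B' b' : ℝ,
      (∀ t, 0 < t → ∀ y ∈ Set.Ioi (0 : ℝ), pStar Dp Dm t x y = FK Dp A a B b t y) ∧
      (∀ t, 0 < t → ∀ y ∈ Set.Iio (0 : ℝ), pStar Dp Dm t x y = FK Dm A' a' B' b' t y) ∧
      ∀ t, 0 < t → FK Dp A a B b t 0 = FK Dm A' a' B' b' t 0 ∧
        Dp * FK1 Dp A a B b t 0 = Dm * FK1 Dm A' a' B' b' t 0 := by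
  obtain ⟨p, hp, rfl⟩ : ∃ p, 0 < p ∧ p ^ 2 = Dp :=
    ⟨√Dp, Real.sqrt_pos.2 hDp, Real.sq_sqrt hDp.le⟩
  obtain ⟨m, hm, rfl⟩ : ∃ m, 0 < m ∧ m ^ 2 = Dm :=
    ⟨√Dm, Real.sqrt_pos.2 hDm, Real.sq_sqrt hDm.le⟩
  have sp : √(p ^ 2) = p := Real.sqrt_sq hp.le
  have sm : √(m ^ 2) = m := Real.sqrt_sq hm.le
  obtain ⟨r, hr, hrr⟩ : ∃ r, 0 < r ∧ √(2 * π) = r := ⟨_, by positivity, rfl⟩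
  have s1 : ∀ t, √(2 * π * t) = r * √t := fun t => by
    rw [Real.sqrt_mul (by positivity), hrr]
  have s2 : ∀ d, 0 < d → ∀ t, √(2 * π * d ^ 2 * t) = r * d * √t := fun d hd t => by
    rw [Real.sqrt_mul (by positivity), Real.sqrt_mul (by positivity), hrr, Real.sqrt_sq hd.le]
  have hpm : 0 < p + m := by positivity
  rcases lt_trichotomy x 0 with hx | hx | hx
  · refine ⟨2 / (p + m) / r, x * p / m, 0, 0, 1 / (r * m), x, -((p - m) / (p + m)) / (r * m), -x,
      ?_, ?_, ?_⟩
    · intro t ht y hy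
      have hy : 0 < y := hy
      rw [pStar, if_neg (by intro h; linarith [h.1]), if_neg (by intro h; linarith [h.2]),
        if_pos ⟨hx.le, hy⟩, sp, sm, s1]
      unfold FK gK
      have : -(y * m - x * p) ^ 2 / (2 * p ^ 2 * m ^ 2 * t)
        = -(y - x * p / m) ^ 2 / (2 * p ^ 2 * t) := by field_simp
      rw [this]
      field_simp
      ring
    · intro t ht y hy
      have hy : y < 0 := hy
      rw [pStar, if_neg (by intro h; linarith [h.1]), if_pos ⟨hx, hy.le⟩, sp, sm, s2 m hm]
      unfold FK gK
      rw [sub_neg_eq_add]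
      field_simp
      ring
    · intro t ht
      have e1 : -(0 - x * p / m) ^ 2 / (2 * p ^ 2 * t) = -x ^ 2 / (2 * m ^ 2 * t) := by
        field_simp; ring
      have e2 : (0 - x) ^ 2 = x ^ 2 := by ring
      have e3 : (0 - -x) ^ 2 = x ^ 2 := by ring
      unfold FK FK1 gK
      rw [e1, e2, e3]
      have hst : 0 < √t := Real.sqrt_pos.2 ht
      constructor
      · field_simp; ring
      · field_simp; ring
  · subst hx
    refine ⟨2 / (p + m) / r, 0, 0, 0, 2 / (p + m) / r, 0, 0, 0, ?_, ?_, ?_⟩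
    · intro t ht y hy
      have hy : 0 < y := hy
      rw [pStar, if_neg (by intro h; linarith [h.1]), if_neg (by intro h; linarith [h.2]),
        if_pos ⟨le_rfl, hy⟩, sp, sm, s1]
      unfold FK gK
      have : -(y * m - 0 * p) ^ 2 / (2 * p ^ 2 * m ^ 2 * t)
        = -(y - 0) ^ 2 / (2 * p ^ 2 * t) := by field_simp; ring
      rw [this]
      field_simp
      ring
    · intro t ht y hy
      have hy : y < 0 := hy
      rw [pStar, if_neg (by intro h; linarith [h.1]), if_neg (by intro h; linarith [h.1]),
        if_neg (by intro h; linarith [h.2]), sp, sm, s1]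
      unfold FK gK
      have : -(y * p - 0 * m) ^ 2 / (2 * p ^ 2 * m ^ 2 * t)
        = -(y - 0) ^ 2 / (2 * m ^ 2 * t) := by field_simp; ring
      rw [this]
      field_simp
      ring
    · intro t ht
      simp [FK, FK1, gK]
  · refine ⟨1 / (r * p), x, ((p - m) / (p + m)) / (r * p), -x, 2 / (p + m) / r, x * m / p, 0, 0,
      ?_, ?_, ?_⟩
    · intro t ht y hy
      have hy : 0 < y := hy
      rw [pStar, if_pos ⟨hx, hy⟩, sp, sm, s2 p hp]
      unfold FK gK
      rw [sub_neg_eq_add]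
      field_simp
    · intro t ht y hy
      have hy : y < 0 := hy
      rw [pStar, if_neg (by intro h; linarith [h.2]), if_neg (by intro h; linarith [h.1]),
        if_neg (by intro h; linarith [h.2]), sp, sm, s1]
      unfold FK gK
      have : -(y * p - x * m) ^ 2 / (2 * p ^ 2 * m ^ 2 * t)
        = -(y - x * m / p) ^ 2 / (2 * m ^ 2 * t) := by field_simp
      rw [this]
      field_simp
      ring
    · intro t ht
      have e1 : -(0 - x * m / p) ^ 2 / (2 * m ^ 2 * t) = -x ^ 2 / (2 * p ^ 2 * t) := by
        field_simp; ring
      have e2 : (0 - x) ^ 2 = x ^ 2 := by ring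
      have e3 : (0 - -x) ^ 2 = x ^ 2 := by ring
      unfold FK FK1 gK
      rw [e1, e2, e3]
      have hst : 0 < √t := Real.sqrt_pos.2 ht
      constructor
      · field_simp; ring
      · field_simp; ring

/-- for fixed backward variable `x`, the function
`(t, y) ↦ p*(t, x, y)` solves the interface heat problem in the forward
variable: (i) the heat equation with coefficient `D(y)/2` away from the
interface, (ii) continuity across the interface, and (iii) continuity of the
diffusive flux across the interface. -/
theorem pStar_forward_interface_problem (Dp Dm : ℝ) (hDp : 0 < Dp) (hDm : 0 < Dm)
    (x : ℝ) :
    (∀ t : ℝ, 0 < t → ∀ y : ℝ, y ≠ 0 →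
      deriv (fun s : ℝ => pStar Dp Dm s x y) t =
        (1 / 2) * (if 0 < y then Dp else Dm) *
          deriv (deriv (fun z : ℝ => pStar Dp Dm t x z)) y) ∧
    (∀ t : ℝ, 0 < t → ∃ c : ℝ,
      Filter.Tendsto (fun y : ℝ => pStar Dp Dm t x y)
        (nhdsWithin 0 (Set.Ioi 0)) (nhds c) ∧
      Filter.Tendsto (fun y : ℝ => pStar Dp Dm t x y)
        (nhdsWithin 0 (Set.Iio 0)) (nhds c)) ∧
    (∀ t : ℝ, 0 < t → ∃ gp gm : ℝ,
      Filter.Tendsto (deriv (fun z : ℝ => pStar Dp Dm t x z))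
        (nhdsWithin 0 (Set.Ioi 0)) (nhds gp) ∧
      Filter.Tendsto (deriv (fun z : ℝ => pStar Dp Dm t x z))
        (nhdsWithin 0 (Set.Iio 0)) (nhds gm) ∧
      Dp * gp = Dm * gm) := by
  obtain ⟨A, a, B, b, A', a', B', b', h1, h2, h3⟩ := rep Dp Dm hDp hDm x
  refine ⟨?_, ?_, ?_⟩
  · intro t ht y hy
    rcases lt_or_gt_of_ne hy with hy | hy
    · rw [if_neg (not_lt.2 hy.le)]
      exact heat_of_rep (fun t y => pStar Dp Dm t x y) _ isOpen_Iio Dm A' a' B' b' hDm h2 t ht y hy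
    · rw [if_pos hy]
      exact heat_of_rep (fun t y => pStar Dp Dm t x y) _ isOpen_Ioi Dp A a B b hDp h1 t ht y hy
  · intro t ht
    refine ⟨FK Dp A a B b t 0, (lim_of_rep _ _ isOpen_Ioi Dp A a B b t hDp ht (h1 t ht)).1, ?_⟩
    rw [(h3 t ht).1]
    exact (lim_of_rep _ _ isOpen_Iio Dm A' a' B' b' t hDm ht (h2 t ht)).1
  · intro t ht
    exact ⟨_, _, (lim_of_rep _ _ isOpen_Ioi Dp A a B b t hDp ht (h1 t ht)).2,
      (lim_of_rep _ _ isOpen_Iio Dm A' a' B' b' t hDm ht (h2 t ht)).2, (h3 t ht).2⟩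
end

section
/- Mass is conserved by the physical skew diffusion density: for every t > 0 and every x ∈ ℝ, ∫_ℝ p*(t,x,y) dy = 1. -/
open MeasureTheory Real Filter Topology

lemma skew_integrable (t s c : ℝ) (ht : 0 < t) (hs : s ≠ 0) :
    Integrable (fun y : ℝ => Real.exp (-(s⁻¹ * y + c) ^ 2 / (2 * t))) := by
  have h0 : Integrable (fun y : ℝ => Real.exp (-(1 / (2 * t)) * y ^ 2)) :=
    integrable_exp_neg_mul_sq (by positivity)
  have h1 := (h0.comp_add_right c).comp_mul_left' (inv_ne_zero hs)
  refine h1.congr (Eventually.of_forall fun y => ?_)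
  simp only
  congr 1
  ring

/-- Gaussian tail. -/
noncomputable def skewQ (t c : ℝ) : ℝ := ∫ z in Set.Ioi (0 : ℝ), Real.exp (-(z + c) ^ 2 / (2 * t))

lemma skew_Ioi (t s c : ℝ) (hs : 0 < s) :
    ∫ y in Set.Ioi (0 : ℝ), Real.exp (-(s⁻¹ * y + c) ^ 2 / (2 * t)) = s * skewQ t c := by
  have h := integral_comp_mul_left_Ioi (fun z : ℝ => Real.exp (-(z + c) ^ 2 / (2 * t))) 0
    (inv_pos.2 hs)
  simpa [skewQ] using h

lemma skew_Iic (t s c : ℝ) (hs : 0 < s) :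
    ∫ y in Set.Iic (0 : ℝ), Real.exp (-(s⁻¹ * y - c) ^ 2 / (2 * t)) = s * skewQ t c := by
  rw [← skew_Ioi t s c hs]
  have h := integral_comp_neg_Iic (0 : ℝ)
    (fun y : ℝ => Real.exp (-(s⁻¹ * y + c) ^ 2 / (2 * t)))
  rw [neg_zero] at h
  rw [← h]
  congr 1
  ext y
  congr 1
  ring

lemma skewQ_add (t c : ℝ) (ht : 0 < t) : skewQ t c + skewQ t (-c) = √(2 * π * t) := by
  have h1 := skew_Iic t 1 (-c) one_pos
  have h2 := skew_Ioi t 1 c one_pos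
  have hi := skew_integrable t 1 c ht one_ne_zero
  have h3 := intervalIntegral.integral_Iic_add_Ioi (b := (0 : ℝ)) hi.integrableOn hi.integrableOn
  simp only [sub_neg_eq_add] at h1
  rw [h1, h2] at h3
  have h4 := integral_add_right_eq_self (μ := volume)
    (fun y : ℝ => Real.exp (-(1 / (2 * t)) * y ^ 2)) c
  rw [integral_gaussian] at h4
  have h5 : π / (1 / (2 * t)) = 2 * π * t := by field_simp
  rw [h5] at h4
  rw [← h4]
  have : (fun y : ℝ => Real.exp (-(1 / (2 * t)) * (y + c) ^ 2)) =
      fun y : ℝ => Real.exp (-((1 : ℝ)⁻¹ * y + c) ^ 2 / (2 * t)) := by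
    ext y
    congr 1
    simp only [inv_one, one_mul]
    ring
  rw [this]
  linarith

/-- Splitting of an integral at zero. -/
lemma skew_split (f g h : ℝ → ℝ) (hg : Integrable g) (hh : Integrable h)
    (h1 : ∀ y, y ≤ 0 → f y = g y) (h2 : ∀ y, 0 < y → f y = h y) :
    ∫ y, f y = (∫ y in Set.Iic (0 : ℝ), g y) + ∫ y in Set.Ioi (0 : ℝ), h y := by
  have e1 : Set.EqOn g f (Set.Iic 0) := fun y hy => (h1 y hy).symm
  have e2 : Set.EqOn h f (Set.Ioi 0) := fun y hy => (h2 y hy).symm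
  rw [setIntegral_congr_fun measurableSet_Iic e1, setIntegral_congr_fun measurableSet_Ioi e2]
  exact (intervalIntegral.integral_Iic_add_Ioi
    (hg.integrableOn.congr_fun e1 measurableSet_Iic)
    (hh.integrableOn.congr_fun e2 measurableSet_Ioi)).symm

/-- mass conservation for the physical skew diffusion density. -/
theorem pStar_integral_eq_one (Dp Dm : ℝ) (hDp : 0 < Dp) (hDm : 0 < Dm)
    (t : ℝ) (ht : 0 < t) (x : ℝ) :
    ∫ y : ℝ, pStar Dp Dm t x y = 1 := by
  obtain ⟨a, ha, rfl⟩ : ∃ a : ℝ, 0 < a ∧ Dp = a ^ 2 :=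
    ⟨√Dp, Real.sqrt_pos.2 hDp, (Real.sq_sqrt hDp.le).symm⟩
  obtain ⟨b, hb, rfl⟩ : ∃ b : ℝ, 0 < b ∧ Dm = b ^ 2 :=
    ⟨√Dm, Real.sqrt_pos.2 hDm, (Real.sq_sqrt hDm.le).symm⟩
  have sa : √(a ^ 2) = a := Real.sqrt_sq ha.le
  have sb : √(b ^ 2) = b := Real.sqrt_sq hb.le
  have hT : 0 < √(2 * π * t) := Real.sqrt_pos.2 (by positivity)
  have sTa : √(2 * π * a ^ 2 * t) = a * √(2 * π * t) := by
    rw [show 2 * π * a ^ 2 * t = a ^ 2 * (2 * π * t) by ring, Real.sqrt_mul (by positivity), sa]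
  have sTb : √(2 * π * b ^ 2 * t) = b * √(2 * π * t) := by
    rw [show 2 * π * b ^ 2 * t = b ^ 2 * (2 * π * t) by ring, Real.sqrt_mul (by positivity), sb]
  have hab : 0 < a + b := by positivity
  -- the transmitted pieces
  have tr1 : ∀ y, -(y * b - x * a) ^ 2 / (2 * a ^ 2 * b ^ 2 * t)
      = -(a⁻¹ * y + -(x / b)) ^ 2 / (2 * t) := fun y => by field_simp; try ring
  have tr2 : ∀ y, -(y * a - x * b) ^ 2 / (2 * a ^ 2 * b ^ 2 * t)
      = -(b⁻¹ * y - x / a) ^ 2 / (2 * t) := fun y => by field_simp; try ring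
  have g1 : ∀ s : ℝ, 0 < s → ∀ y, -(y - x) ^ 2 / (2 * s ^ 2 * t)
      = -(s⁻¹ * y + -(x / s)) ^ 2 / (2 * t) := fun s hs y => by field_simp; try ring
  have g2 : ∀ s : ℝ, 0 < s → ∀ y, -(y + x) ^ 2 / (2 * s ^ 2 * t)
      = -(s⁻¹ * y + x / s) ^ 2 / (2 * t) := fun s hs y => by field_simp
  have ia := fun c => skew_integrable t a c ht ha.ne'
  have ib := fun c => skew_integrable t b c ht hb.ne'
  have ib' : ∀ c, Integrable (fun y : ℝ => Real.exp (-(b⁻¹ * y - c) ^ 2 / (2 * t))) :=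
    fun c => by simpa only [sub_eq_add_neg] using ib (-c)
  rcases lt_trichotomy x 0 with hx | hx | hx
  · rw [skew_split (fun y => pStar (a ^ 2) (b ^ 2) t x y)
      (fun y => (b * √(2 * π * t))⁻¹ * (Real.exp (-(b⁻¹ * y - x / b) ^ 2 / (2 * t)) -
        ((a - b) / (a + b)) * Real.exp (-(b⁻¹ * y - -(x / b)) ^ 2 / (2 * t))))
      (fun y => (2 / (a + b)) * (√(2 * π * t))⁻¹ *
        Real.exp (-(a⁻¹ * y + -(x / b)) ^ 2 / (2 * t)))
      (((ib' _).sub ((ib' _).const_mul _)).const_mul _) ((ia _).const_mul _)]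
    · rw [integral_const_mul, integral_const_mul,
        integral_sub (ib' _).integrableOn ((ib' _).const_mul _).integrableOn,
        integral_const_mul, skew_Iic _ _ _ hb, skew_Iic _ _ _ hb, skew_Ioi _ _ _ ha]
      have hQ := skewQ_add t (x / b) ht
      rw [← hQ] at hT ⊢
      field_simp
      ring
    · intro y hy
      simp only [pStar, hx.not_gt, hx, hy, false_and, true_and, if_true, if_false, sa, sb, sTb,
        g1 b hb, g2 b hb, sub_neg_eq_add, ← sub_eq_add_neg]
    · intro y hy
      simp only [pStar, hx.not_gt, hx, hx.le, hy, hy.not_ge, false_and, true_and, and_false,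
        if_true, if_false, sa, sb, tr1]
  · rw [skew_split (fun y => pStar (a ^ 2) (b ^ 2) t x y)
      (fun y => (2 / (a + b)) * (√(2 * π * t))⁻¹ *
        Real.exp (-(b⁻¹ * y - x / a) ^ 2 / (2 * t)))
      (fun y => (2 / (a + b)) * (√(2 * π * t))⁻¹ *
        Real.exp (-(a⁻¹ * y + -(x / b)) ^ 2 / (2 * t)))
      ((ib' _).const_mul _) ((ia _).const_mul _)]
    · rw [integral_const_mul, integral_const_mul, skew_Iic _ _ _ hb, skew_Ioi _ _ _ ha]
      have hQ := skewQ_add t 0 ht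
      rw [hx]
      simp only [zero_div, neg_zero] at hQ ⊢
      rw [← hQ] at hT ⊢
      have : skewQ t 0 ≠ 0 := fun h => by simp [h] at hT
      field_simp
      ring
    · intro y hy
      simp only [pStar, hx.not_gt, hx.not_lt, hy.not_gt, false_and, and_false,
        if_false, sa, sb, tr2]
    · intro y hy
      simp only [pStar, hx.not_gt, hx.not_lt, hx.le, hy, false_and, true_and,
        if_true, if_false, sa, sb, tr1]
  · rw [skew_split (fun y => pStar (a ^ 2) (b ^ 2) t x y)
      (fun y => (2 / (a + b)) * (√(2 * π * t))⁻¹ *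
        Real.exp (-(b⁻¹ * y - x / a) ^ 2 / (2 * t)))
      (fun y => (a * √(2 * π * t))⁻¹ * (Real.exp (-(a⁻¹ * y + -(x / a)) ^ 2 / (2 * t)) +
        ((a - b) / (a + b)) * Real.exp (-(a⁻¹ * y + x / a) ^ 2 / (2 * t))))
      ((ib' _).const_mul _) (((ia _).add ((ia _).const_mul _)).const_mul _)]
    · rw [integral_const_mul, integral_const_mul,
        integral_add (ia _).integrableOn ((ia _).const_mul _).integrableOn,
        integral_const_mul, skew_Iic _ _ _ hb, skew_Ioi _ _ _ ha, skew_Ioi _ _ _ ha]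
      have hQ := skewQ_add t (x / a) ht
      rw [← hQ] at hT ⊢
      field_simp
      ring
    · intro y hy
      simp only [pStar, hx.not_gt, hx.not_ge, hy.not_gt, false_and, and_false,
        if_false, sa, sb, tr2]
    · intro y hy
      simp only [pStar, hx, hy, true_and, if_true, sa, sb, sTa, g1 a ha, g2 a ha]
end

section
/- The physical skew diffusion density satisfies the Chapman–Kolmogorov (semigroup) equations: for all s > 0, t > 0 and all x, y ∈ ℝ, ∫_ℝ p*(s,x,z)·p*(t,z,y) dz = p*(s+t,x,y). -/
open MeasureTheory Real Filter Topology

/-- Centered Gaussian density. -/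
noncomputable def skG (t u : ℝ) : ℝ := (Real.sqrt (2 * Real.pi * t))⁻¹ * Real.exp (-u ^ 2 / (2 * t))

/-- Scale. -/
noncomputable def skS (a b y : ℝ) : ℝ := if 0 < y then a else b

/-- Sign. -/
noncomputable def skE (y : ℝ) : ℝ := if 0 < y then 1 else -1

/-- Rescaled kernel. -/
noncomputable def skQ (γ t e x y : ℝ) : ℝ := skG t (y - x) + γ * e * skG t (|x| + |y|)

lemma skG_neg (t u : ℝ) : skG t (-u) = skG t u := by simp [skG]

lemma skS_pos {a b : ℝ} (ha : 0 < a) (hb : 0 < b) (y : ℝ) : 0 < skS a b y := by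
  unfold skS; split_ifs <;> assumption

lemma skG_mul {s t : ℝ} (hs : 0 < s) (ht : 0 < t) (x y z : ℝ) :
    skG s (z - x) * skG t (y - z) =
      ((Real.sqrt (2 * Real.pi * s))⁻¹ * (Real.sqrt (2 * Real.pi * t))⁻¹ *
        Real.exp (-(y - x) ^ 2 / (2 * (s + t)))) *
        Real.exp (-((s + t) / (2 * s * t)) * (z - (t * x + s * y) / (s + t)) ^ 2) := by
  have hst : 0 < s + t := by positivity
  have h : Real.exp (-(z - x) ^ 2 / (2 * s)) * Real.exp (-(y - z) ^ 2 / (2 * t)) =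
      Real.exp (-(y - x) ^ 2 / (2 * (s + t))) *
        Real.exp (-((s + t) / (2 * s * t)) * (z - (t * x + s * y) / (s + t)) ^ 2) := by
    rw [← Real.exp_add, ← Real.exp_add]
    congr 1
    field_simp
    ring
  unfold skG
  linear_combination ((Real.sqrt (2 * Real.pi * s))⁻¹ * (Real.sqrt (2 * Real.pi * t))⁻¹) * h

lemma skG_integrable {s t : ℝ} (hs : 0 < s) (ht : 0 < t) (x y : ℝ) :
    Integrable (fun z => skG s (z - x) * skG t (y - z)) := by
  simp_rw [skG_mul hs ht]
  apply Integrable.const_mul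
  exact (integrable_exp_neg_mul_sq (b := (s + t) / (2 * s * t)) (by positivity)).comp_sub_right _

lemma skG_conv {s t : ℝ} (hs : 0 < s) (ht : 0 < t) (x y : ℝ) :
    ∫ z, skG s (z - x) * skG t (y - z) = skG (s + t) (y - x) := by
  simp_rw [skG_mul hs ht]
  rw [integral_const_mul,
    integral_sub_right_eq_self (fun z => Real.exp (-((s + t) / (2 * s * t)) * z ^ 2)),
    integral_gaussian]
  unfold skG
  have h : (Real.sqrt (2 * Real.pi * s))⁻¹ * (Real.sqrt (2 * Real.pi * t))⁻¹ *
      Real.sqrt (Real.pi / ((s + t) / (2 * s * t))) = (Real.sqrt (2 * Real.pi * (s + t)))⁻¹ := by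
    rw [← Real.sqrt_inv, ← Real.sqrt_inv, ← Real.sqrt_inv, ← Real.sqrt_mul (by positivity),
      ← Real.sqrt_mul (by positivity)]
    congr 1
    field_simp
  rw [← h]; ring

lemma pStar_eq {a b t : ℝ} (ha : 0 < a) (hb : 0 < b) (ht : 0 < t) (x y : ℝ) :
    pStar (a ^ 2) (b ^ 2) t x y =
      (skS a b y)⁻¹ * skQ ((a - b) / (a + b)) t (skE y) (x / skS a b x) (y / skS a b y) := by
  have hab : 0 < a + b := by positivity
  have hA : Real.sqrt (2 * Real.pi * a ^ 2 * t) = a * Real.sqrt (2 * Real.pi * t) := by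
    rw [show 2 * Real.pi * a ^ 2 * t = a ^ 2 * (2 * Real.pi * t) by ring,
      Real.sqrt_mul (by positivity), Real.sqrt_sq ha.le]
  have hB : Real.sqrt (2 * Real.pi * b ^ 2 * t) = b * Real.sqrt (2 * Real.pi * t) := by
    rw [show 2 * Real.pi * b ^ 2 * t = b ^ 2 * (2 * Real.pi * t) by ring,
      Real.sqrt_mul (by positivity), Real.sqrt_sq hb.le]
  have hr : 0 < Real.sqrt (2 * Real.pi * t) := by positivity
  unfold pStar
  rw [Real.sqrt_sq ha.le, Real.sqrt_sq hb.le, hA, hB]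
  unfold skQ skG skS skE
  by_cases hx : 0 < x
  · by_cases hy : 0 < y
    · simp only [hx, hy, and_self, if_true]
      rw [abs_of_pos (div_pos hx ha), abs_of_pos (div_pos hy ha),
        show -(y - x) ^ 2 / (2 * a ^ 2 * t) = -(y / a - x / a) ^ 2 / (2 * t) by field_simp,
        show -(y + x) ^ 2 / (2 * a ^ 2 * t) = -(x / a + y / a) ^ 2 / (2 * t) by field_simp; ring]
      field_simp
    · have hx1 : ¬ x < 0 := not_lt.2 hx.le
      have hx2 : ¬ x ≤ 0 := not_le.2 hx
      simp only [hx, hy, hx1, hx2, and_false, false_and, if_false, if_true]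
      rw [abs_of_pos (div_pos hx ha), abs_of_nonpos (div_nonpos_of_nonpos_of_nonneg (not_lt.1 hy) hb.le),
        show -(y * a - x * b) ^ 2 / (2 * a ^ 2 * b ^ 2 * t) = -(y / b - x / a) ^ 2 / (2 * t) by
          field_simp,
        show -(x / a + -(y / b)) ^ 2 / (2 * t) = -(y / b - x / a) ^ 2 / (2 * t) by ring]
      field_simp
      ring
  · have hx' := not_lt.1 hx
    by_cases hy : 0 < y
    · have hy2 : ¬ y ≤ 0 := not_le.2 hy
      simp only [hx, hy, hx', hy2, and_false, false_and, and_self, if_false, if_true]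
      rw [abs_of_pos (div_pos hy ha), abs_of_nonpos (div_nonpos_of_nonpos_of_nonneg hx' hb.le),
        show -(y * b - x * a) ^ 2 / (2 * a ^ 2 * b ^ 2 * t) = -(y / a - x / b) ^ 2 / (2 * t) by
          field_simp,
        show -(-(x / b) + y / a) ^ 2 / (2 * t) = -(y / a - x / b) ^ 2 / (2 * t) by ring]
      field_simp
      ring
    · have hy' := not_lt.1 hy
      rcases hx'.lt_or_eq with hx0 | hx0
      · simp only [hx, hy, hx0, hy', false_and, and_self, if_false, if_true]
        rw [abs_of_nonpos (div_nonpos_of_nonpos_of_nonneg hx' hb.le),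
          abs_of_nonpos (div_nonpos_of_nonpos_of_nonneg hy' hb.le),
          show -(y - x) ^ 2 / (2 * b ^ 2 * t) = -(y / b - x / b) ^ 2 / (2 * t) by field_simp,
          show -(y + x) ^ 2 / (2 * b ^ 2 * t) = -(-(x / b) + -(y / b)) ^ 2 / (2 * t) by
            field_simp; ring]
        field_simp
        ring
      · subst hx0
        simp only [hy, lt_irrefl, and_false, false_and, if_false, zero_div, abs_zero, zero_mul,
          sub_zero, zero_add, sq_abs]
        rw [show -(y * a) ^ 2 / (2 * a ^ 2 * b ^ 2 * t) = -(y / b) ^ 2 / (2 * t) by field_simp]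
        field_simp
        ring

lemma sk_pair (γ s t e x y z : ℝ) (he : e = skE y) (hz : 0 < z) :
    skQ γ s 1 x z * skQ γ t e z y + skQ γ s (-1) x (-z) * skQ γ t e (-z) y =
      (skG s (z - x) * skG t (y - z) + γ * e * (skG s (z - -|x|) * skG t (|y| - z))) +
      (skG s (-z - x) * skG t (y - -z) + γ * e * (skG s (-z - -|x|) * skG t (|y| - -z))) := by
  subst he
  have e1 : skG s (-z - x) = skG s (z + x) := by rw [← skG_neg]; ring_nf
  have e2 : skG s (-z - -|x|) = skG s (z - |x|) := by rw [← skG_neg]; ring_nf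
  have e3 : skG s (|x| + z) = skG s (z + |x|) := by rw [add_comm]
  have e4 : skG t (z + |y|) = skG t (|y| + z) := by rw [add_comm]
  unfold skQ
  rw [abs_neg, abs_of_pos hz, e1, e2, e3, e4]
  simp only [sub_neg_eq_add]
  have hX : skG s (z - x) + skG s (z + x) = skG s (z - |x|) + skG s (z + |x|) := by
    rcases abs_cases x with ⟨h, _⟩ | ⟨h, _⟩ <;> rw [h]
    simp only [sub_neg_eq_add, ← sub_eq_add_neg]; ring
  have hY : skG t (y - z) - skG t (y + z) = skE y * (skG t (|y| - z) - skG t (|y| + z)) := by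
    unfold skE
    split_ifs with h
    · rw [abs_of_pos h]; ring
    · rw [abs_of_nonpos (not_lt.1 h), ← skG_neg t (y - z), ← skG_neg t (y + z)]
      ring_nf
  linear_combination γ * skE y * skG t (|y| + z) * hX + γ * skG s (z + |x|) * hY

lemma sk_split {f : ℝ → ℝ} (h1 : IntegrableOn f (Set.Ioi 0))
    (h2 : IntegrableOn (fun z => f (-z)) (Set.Ioi 0)) :
    ∫ z, f z = (∫ z in Set.Ioi (0:ℝ), f z) + ∫ z in Set.Ioi (0:ℝ), f (-z) := by
  have h3 : IntegrableOn f (Set.Iic 0) := by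
    rw [integrableOn_Iic_iff_integrableOn_Iio]
    have := h2.comp_neg
    simpa using this
  rw [integral_comp_neg_Ioi, neg_zero, add_comm]
  exact (intervalIntegral.integral_Iic_add_Ioi h3 h1).symm

lemma skQ_integrableOn (γ : ℝ) {s t : ℝ} (hs : 0 < s) (ht : 0 < t) (e e' x y : ℝ) :
    IntegrableOn (fun z => skQ γ s e x z * skQ γ t e' z y) (Set.Ioi 0) := by
  have h : Integrable (fun z => skG s (z - x) * skG t (y - z)
      + γ * e' * (skG s (z - x) * skG t (-|y| - z))
      + γ * e * (skG s (z - -|x|) * skG t (y - z))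
      + γ * e * (γ * e') * (skG s (z - -|x|) * skG t (-|y| - z))) :=
    (((skG_integrable hs ht _ _).add ((skG_integrable hs ht _ _).const_mul _)).add
      ((skG_integrable hs ht _ _).const_mul _)).add ((skG_integrable hs ht _ _).const_mul _)
  refine h.integrableOn.congr_fun (fun z hz => ?_) measurableSet_Ioi
  have hz : 0 < z := hz
  have e1 : skG t (-|y| - z) = skG t (z + |y|) := by rw [← skG_neg]; ring_nf
  have e2 : skG s (z - -|x|) = skG s (|x| + z) := by ring_nf
  simp only [skQ, abs_of_pos hz, e1, e2]
  ring

lemma skQ_neg_neg (γ t e x y : ℝ) : skQ γ t e (-x) (-y) = skQ γ t e x y := by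
  unfold skQ
  rw [abs_neg, abs_neg, ← skG_neg]
  ring_nf

theorem sk_main {a b s t : ℝ} (ha : 0 < a) (hb : 0 < b) (hs : 0 < s) (ht : 0 < t) (x y : ℝ) :
    ∫ z : ℝ, pStar (a ^ 2) (b ^ 2) s x z * pStar (a ^ 2) (b ^ 2) t z y =
      pStar (a ^ 2) (b ^ 2) (s + t) x y := by
  set f : ℝ → ℝ := fun z => pStar (a ^ 2) (b ^ 2) s x z * pStar (a ^ 2) (b ^ 2) t z y with hf
  set γ := (a - b) / (a + b) with hγ
  set X := x / skS a b x with hX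
  set Y := y / skS a b y with hY
  set c := (skS a b y)⁻¹ with hc
  have hE : skE y = skE Y := by
    have : 0 < Y ↔ 0 < y := by
      rw [hY, div_pos_iff_of_pos_right (skS_pos ha hb y)]
    simp [skE, this]
  have f1 : ∀ z ∈ Set.Ioi (0:ℝ), f (a * z) =
      a⁻¹ * c * (skQ γ s 1 X z * skQ γ t (skE y) z Y) := by
    intro z hz
    have hz : 0 < z := hz
    have h0 : 0 < a * z := by positivity
    have hSz : skS a b (a * z) = a := by simp [skS, h0]
    have hEz : skE (a * z) = 1 := by simp [skE, h0]
    simp only [hf]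
    rw [pStar_eq ha hb hs, pStar_eq ha hb ht, hSz, hEz, mul_div_cancel_left₀ _ ha.ne']
    ring
  have f2 : ∀ z ∈ Set.Ioi (0:ℝ), f (-(b * z)) =
      b⁻¹ * c * (skQ γ s (-1) X (-z) * skQ γ t (skE y) (-z) Y) := by
    intro z hz
    have hz : 0 < z := hz
    have h0 : ¬ 0 < -(b * z) := by
      have : 0 < b * z := by positivity
      linarith
    have hSz : skS a b (-(b * z)) = b := by simp only [skS, h0, if_false]
    have hEz : skE (-(b * z)) = -1 := by simp only [skE, h0, if_false]
    have hd : -(b * z) / b = -z := by field_simp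
    simp only [hf]
    rw [pStar_eq ha hb hs, pStar_eq ha hb ht, hSz, hEz, hd]
    ring
  have i1 : IntegrableOn (fun z => skQ γ s 1 X z * skQ γ t (skE y) z Y) (Set.Ioi 0) :=
    skQ_integrableOn γ hs ht _ _ _ _
  have i2 : IntegrableOn (fun z => skQ γ s (-1) X (-z) * skQ γ t (skE y) (-z) Y) (Set.Ioi 0) := by
    have := skQ_integrableOn γ hs ht (-1) (skE y) (-X) (-Y)
    refine this.congr_fun (fun z _ => ?_) measurableSet_Ioi
    simp only
    rw [← skQ_neg_neg γ s (-1) (-X) z, ← skQ_neg_neg γ t _ z (-Y), neg_neg, neg_neg]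
  have j1 : IntegrableOn f (Set.Ioi 0) := by
    have := (integrableOn_Ioi_comp_mul_left_iff f 0 ha).1
      (IntegrableOn.congr_fun (i1.const_mul (a⁻¹ * c)) (fun z hz => (f1 z hz).symm)
        measurableSet_Ioi)
    simpa using this
  have j2 : IntegrableOn (fun z => f (-z)) (Set.Ioi 0) := by
    have := (integrableOn_Ioi_comp_mul_left_iff (fun z => f (-z)) 0 hb).1
      (IntegrableOn.congr_fun (i2.const_mul (b⁻¹ * c)) (fun z hz => (f2 z hz).symm)
        measurableSet_Ioi)
    simpa using this
  have k1 : ∫ z in Set.Ioi (0:ℝ), f z =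
      c * ∫ z in Set.Ioi (0:ℝ), skQ γ s 1 X z * skQ γ t (skE y) z Y := by
    have h := integral_comp_mul_left_Ioi f 0 ha
    rw [setIntegral_congr_fun measurableSet_Ioi f1, integral_const_mul, mul_zero,
      smul_eq_mul] at h
    field_simp at h
    linarith
  have k2 : ∫ z in Set.Ioi (0:ℝ), f (-z) =
      c * ∫ z in Set.Ioi (0:ℝ), skQ γ s (-1) X (-z) * skQ γ t (skE y) (-z) Y := by
    have h := integral_comp_mul_left_Ioi (fun z => f (-z)) 0 hb
    rw [setIntegral_congr_fun measurableSet_Ioi f2, integral_const_mul, mul_zero,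
      smul_eq_mul] at h
    field_simp at h
    linarith
  set h : ℝ → ℝ := fun z => skG s (z - X) * skG t (Y - z) +
    γ * skE y * (skG s (z - -|X|) * skG t (|Y| - z)) with hh
  have ih : Integrable h :=
    (skG_integrable hs ht _ _).add ((skG_integrable hs ht _ _).const_mul _)
  have hint : ∫ z, h z = skQ γ (s + t) (skE y) X Y := by
    rw [hh, integral_add (skG_integrable hs ht _ _) ((skG_integrable hs ht _ _).const_mul _),
      integral_const_mul, skG_conv hs ht, skG_conv hs ht]
    unfold skQ
    rw [sub_neg_eq_add, add_comm |Y|]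
  rw [sk_split j1 j2, k1, k2, ← mul_add, ← integral_add i1 i2,
    setIntegral_congr_fun measurableSet_Ioi
      (fun z hz => sk_pair γ s t (skE y) X Y z hE hz),
    pStar_eq ha hb (by positivity), ← hint, sk_split ih.integrableOn ih.comp_neg.integrableOn,
    ← integral_add ih.integrableOn ih.comp_neg.integrableOn]

/-- Chapman–Kolmogorov equations for the physical skew
diffusion density. -/
theorem pStar_chapman_kolmogorov (Dp Dm : ℝ) (hDp : 0 < Dp) (hDm : 0 < Dm)
    (s t : ℝ) (hs : 0 < s) (ht : 0 < t) (x y : ℝ) :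
    ∫ z : ℝ, pStar Dp Dm s x z * pStar Dp Dm t z y = pStar Dp Dm (s + t) x y := by
  have h := sk_main (Real.sqrt_pos.2 hDp) (Real.sqrt_pos.2 hDm) hs ht x y
  rwa [Real.sq_sqrt hDp.le, Real.sq_sqrt hDm.le] at h
end

section
/- The physical skew diffusion density attains the initial condition: for every bounded continuous function u₀ : ℝ → ℝ and every x ∈ ℝ, lim_{t→0⁺} ∫_ℝ p*(t,x,y)·u₀(y) dy = u₀(x). -/
open MeasureTheory Real Filter Topology

/-- Approximate identity lemma with a Gaussian bound. -/
theorem approx_id_aux (p : ℝ → ℝ → ℝ) (x C m : ℝ) (hm : 0 < m) (G : ℝ → ℝ)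
    (hmeas : ∀ t, Measurable (p t))
    (hb : ∀ t, 0 < t → ∀ y, |p t y| ≤ C * (√t)⁻¹ * Real.exp (-m * ((y - x) ^ 2 / t)))
    (hlim : ∀ z, Tendsto (fun t => √t * p t (x + √t * z)) (𝓝[>] 0) (𝓝 (G z)))
    (hG : ∫ z, G z = 1)
    (u : ℝ → ℝ) (hcont : Continuous u) (hbdd : ∃ M : ℝ, ∀ y : ℝ, |u y| ≤ M) :
    Tendsto (fun t : ℝ => ∫ y : ℝ, p t y * u y) (𝓝[>] 0) (𝓝 (u x)) := by
  obtain ⟨M, hM⟩ := hbdd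
  have hs : Tendsto (fun t : ℝ => √t) (𝓝[>] 0) (𝓝 0) := by
    have := (Real.continuous_sqrt.tendsto 0).mono_left (nhdsWithin_le_nhds (s := Set.Ioi 0))
    simpa using this
  have key : Tendsto (fun t : ℝ => ∫ z : ℝ, √t * p t (x + √t * z) * u (x + √t * z)) (𝓝[>] 0)
      (𝓝 (∫ z, G z * u x)) := by
    apply tendsto_integral_filter_of_dominated_convergence
      (fun z => C * Real.exp (-m * z ^ 2) * M)
    · refine Eventually.of_forall fun t => Measurable.aestronglyMeasurable ?_
      have h1 : Measurable fun z : ℝ => x + √t * z := by fun_prop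
      exact (((hmeas t).comp h1).const_mul _).mul (hcont.measurable.comp h1)
    · filter_upwards [self_mem_nhdsWithin] with t ht
      refine Eventually.of_forall fun z => ?_
      have ht' : 0 < t := ht
      have hst : 0 < √t := Real.sqrt_pos.2 ht'
      have h2 := hb t ht' (x + √t * z)
      have e : (x + √t * z - x) ^ 2 / t = z ^ 2 := by
        rw [add_sub_cancel_left, mul_pow, Real.sq_sqrt ht'.le]; field_simp
      rw [e] at h2
      rw [Real.norm_eq_abs, abs_mul, abs_mul, abs_of_pos hst]
      have h3 : √t * |p t (x + √t * z)| ≤ C * Real.exp (-m * z ^ 2) := by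
        calc _ ≤ √t * (C * (√t)⁻¹ * Real.exp (-m * z ^ 2)) := by gcongr
          _ = _ := by field_simp
      exact mul_le_mul h3 (hM _) (abs_nonneg _) (le_trans (by positivity) h3)
    · exact ((integrable_exp_neg_mul_sq hm).const_mul C).mul_const M
    · refine Eventually.of_forall fun z => (hlim z).mul ?_
      have : Tendsto (fun t : ℝ => x + √t * z) (𝓝[>] 0) (𝓝 x) := by
        simpa using (hs.mul_const z).const_add x
      exact (hcont.tendsto x).comp this
  rw [integral_mul_const, hG, one_mul] at key
  refine key.congr' ?_
  filter_upwards [self_mem_nhdsWithin] with t ht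
  have ht' : 0 < t := ht
  have hst : 0 < √t := Real.sqrt_pos.2 ht'
  simp_rw [mul_assoc]
  rw [integral_const_mul,
    Measure.integral_comp_mul_left (fun w => p t (x + w) * u (x + w)) (√t),
    integral_add_left_eq_self (fun w => p t w * u w) x, abs_of_pos (inv_pos.2 hst), smul_eq_mul,
    ← mul_assoc, mul_inv_cancel₀ hst.ne', one_mul]

theorem pStar_meas (Dp Dm t x : ℝ) : Measurable (pStar Dp Dm t x) := by
  unfold pStar
  refine Measurable.ite ?_ (by fun_prop) (Measurable.ite ?_ (by fun_prop)
    (Measurable.ite ?_ (by fun_prop) (by fun_prop)))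
  · exact (MeasurableSet.const _).inter measurableSet_Ioi
  · exact (MeasurableSet.const _).inter measurableSet_Iic
  · exact (MeasurableSet.const _).inter measurableSet_Ioi

theorem coef_le (a b : ℝ) (ha : 0 < a) (hb : 0 < b) : |(a - b) / (a + b)| ≤ 1 := by
  rw [abs_div, abs_of_pos (add_pos ha hb), div_le_one (add_pos ha hb), abs_le]
  constructor <;> linarith

theorem exp_cross (Dp Dm t A B d m : ℝ) (hDp : 0 < Dp) (hDm : 0 < Dm) (ht : 0 < t)
    (hm1 : m ≤ 1 / (2 * Dp)) (hm2 : m ≤ 1 / (2 * Dm)) (hm : 0 < m)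
    (hA : 0 ≤ A) (hB : 0 ≤ B) (hd : d ^ 2 = (A + B) ^ 2) :
    Real.exp (-(A * √Dm + B * √Dp) ^ 2 / (2 * Dp * Dm * t)) ≤ Real.exp (-m * (d ^ 2 / t)) := by
  apply Real.exp_le_exp.2
  rw [hd, neg_div, neg_mul]
  apply neg_le_neg
  have ha := Real.sq_sqrt hDp.le
  have hb := Real.sq_sqrt hDm.le
  have hap := Real.sqrt_pos.2 hDp
  have hbp := Real.sqrt_pos.2 hDm
  rw [le_div_iff₀ (by positivity)] at hm1 hm2
  have hmid : m * (2 * Dp * Dm) ≤ √Dp * √Dm := by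
    have h1 : m * (2 * Dp * Dm) ≤ Dm := by nlinarith
    have h2 : m * (2 * Dp * Dm) ≤ Dp := by nlinarith
    refine (pow_le_pow_iff_left₀ (by positivity) (by positivity) two_ne_zero).1 ?_
    rw [mul_pow (√Dp), ha, hb, sq]
    exact mul_le_mul h2 h1 (by positivity) hDp.le
  have e : m * ((A + B) ^ 2 / t) = (m * (2 * Dp * Dm) * (A + B) ^ 2) / (2 * Dp * Dm * t) := by
    field_simp
  rw [e]
  gcongr
  have h1 : m * (2 * Dp * Dm) ≤ Dm := by nlinarith
  have h2 : m * (2 * Dp * Dm) ≤ Dp := by nlinarith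
  have e2 : (A * √Dm + B * √Dp) ^ 2 = A ^ 2 * Dm + 2 * (A * B) * (√Dp * √Dm) + B ^ 2 * Dp := by
    rw [← ha, ← hb]; simp only [Real.sqrt_sq hap.le, Real.sqrt_sq hbp.le]; ring
  rw [e2]
  have := mul_le_mul_of_nonneg_left h1 (sq_nonneg A)
  have := mul_le_mul_of_nonneg_left h2 (sq_nonneg B)
  have := mul_le_mul_of_nonneg_left hmid (mul_nonneg hA hB)
  nlinarith

theorem exp_same (D t d e m : ℝ) (hD : 0 < D) (ht : 0 < t)
    (hm1 : m ≤ 1 / (2 * D)) (hd : d ^ 2 ≤ e ^ 2) :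
    Real.exp (-e ^ 2 / (2 * D * t)) ≤ Real.exp (-m * (d ^ 2 / t)) := by
  apply Real.exp_le_exp.2
  rw [neg_div, neg_mul]
  apply neg_le_neg
  calc m * (d ^ 2 / t) ≤ 1 / (2 * D) * (e ^ 2 / t) := by gcongr
    _ = _ := by field_simp

theorem pStar_bound (Dp Dm : ℝ) (hDp : 0 < Dp) (hDm : 0 < Dm) (x : ℝ) :
    ∃ C m : ℝ, 0 < m ∧ ∀ t, 0 < t → ∀ y,
      |pStar Dp Dm t x y| ≤ C * (√t)⁻¹ * Real.exp (-m * ((y - x) ^ 2 / t)) := by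
  have hap := Real.sqrt_pos.2 hDp
  have hbp := Real.sqrt_pos.2 hDm
  have hc := coef_le _ _ hap hbp
  set c := (√Dp - √Dm) / (√Dp + √Dm) with hcdef
  set K1 := (√(2 * π * Dp))⁻¹ * 2
  set K2 := (√(2 * π * Dm))⁻¹ * 2
  set K3 := 2 / (√Dp + √Dm) * (√(2 * π))⁻¹
  have k1 : 0 ≤ K1 := by positivity
  have k2 : 0 ≤ K2 := by positivity
  have k3 : 0 ≤ K3 := by positivity
  have hm : 0 < min (1 / (2 * Dp)) (1 / (2 * Dm)) := lt_min (by positivity) (by positivity)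
  refine ⟨K1 + K2 + K3, min (1 / (2 * Dp)) (1 / (2 * Dm)), hm, ?_⟩
  have hm1 : min (1 / (2 * Dp)) (1 / (2 * Dm)) ≤ _ := min_le_left _ _
  have hm2 : min (1 / (2 * Dp)) (1 / (2 * Dm)) ≤ _ := min_le_right _ _
  generalize min (1 / (2 * Dp)) (1 / (2 * Dm)) = m at hm hm1 hm2
  intro t ht y
  have hst : 0 < √t := Real.sqrt_pos.2 ht
  have fin : ∀ K, K ≤ K1 + K2 + K3 → ∀ w, |w| ≤ K * (√t)⁻¹ * Real.exp (-m * ((y - x) ^ 2 / t)) →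
      |w| ≤ (K1 + K2 + K3) * (√t)⁻¹ * Real.exp (-m * ((y - x) ^ 2 / t)) := by
    intro K hK w hw
    refine hw.trans ?_
    gcongr
  have two : ∀ E1 E2 E c' : ℝ, 0 ≤ E1 → 0 ≤ E2 → E1 ≤ E → E2 ≤ E → |c'| ≤ 1 →
      |E1 + c' * E2| ≤ 2 * E := by
    intro E1 E2 E c' h1 h2 h3 h4 h5
    calc |E1 + c' * E2| ≤ |E1| + |c' * E2| := abs_add_le _ _
      _ = E1 + |c'| * E2 := by rw [abs_mul, abs_of_nonneg h1, abs_of_nonneg h2]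
      _ ≤ 2 * E := by nlinarith
  have sq1 : ∀ D : ℝ, 0 < D → √(2 * π * D * t) = √(2 * π * D) * √t := fun D hD =>
    Real.sqrt_mul (by positivity) t
  have sq2 : √(2 * π * t) = √(2 * π) * √t := Real.sqrt_mul (by positivity) t
  unfold pStar
  simp only [← hcdef]
  split_ifs with h1 h2 h3
  · apply fin K1 (by linarith)
    rw [abs_mul, sq1 Dp hDp, abs_of_nonneg (by positivity)]
    have := two _ _ _ c (Real.exp_nonneg _) (Real.exp_nonneg _)
      (exp_same Dp t (y - x) (y - x) m hDp ht hm1 le_rfl)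
      (exp_same Dp t (y - x) (y + x) m hDp ht hm1 (by nlinarith [h1.1, h1.2, mul_pos h1.1 h1.2])) hc
    calc _ ≤ (√(2 * π * Dp) * √t)⁻¹ * (2 * Real.exp (-m * ((y - x) ^ 2 / t))) := by gcongr
      _ = _ := by simp only [K1]; rw [mul_inv]; ring
  · apply fin K2 (by linarith)
    rw [abs_mul, sq1 Dm hDm, abs_of_nonneg (by positivity)]
    have := two _ _ _ (-c) (Real.exp_nonneg _) (Real.exp_nonneg _)
      (exp_same Dm t (y - x) (y - x) m hDm ht hm2 le_rfl)
      (exp_same Dm t (y - x) (y + x) m hDm ht hm2 (by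
        nlinarith [mul_nonneg (neg_nonneg.2 h2.1.le) (neg_nonneg.2 h2.2)])) (by rwa [abs_neg])
    rw [neg_mul, ← sub_eq_add_neg] at this
    calc _ ≤ (√(2 * π * Dm) * √t)⁻¹ * (2 * Real.exp (-m * ((y - x) ^ 2 / t))) := by gcongr
      _ = _ := by simp only [K2]; rw [mul_inv]; ring
  · apply fin K3 (by linarith)
    rw [abs_of_nonneg (by positivity), sq2]
    have := exp_cross Dp Dm t y (-x) (y - x) m hDp hDm ht hm1 hm2 hm h3.2.le
      (neg_nonneg.2 h3.1) (by ring)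
    rw [show y * √Dm + -x * √Dp = y * √Dm - x * √Dp by ring] at this
    calc _ ≤ 2 / (√Dp + √Dm) * (√(2 * π) * √t)⁻¹ * Real.exp (-m * ((y - x) ^ 2 / t)) := by gcongr
      _ = _ := by simp only [K3]; rw [mul_inv]; ring
  · apply fin K3 (by linarith)
    have hx : 0 ≤ x := by
      by_contra! h
      rcases le_or_gt y 0 with hy | hy
      · exact h2 ⟨h, hy⟩
      · exact h3 ⟨h.le, hy⟩
    have hy : y ≤ 0 := by
      by_contra! h
      rcases hx.eq_or_lt with hx | hx
      · exact h3 ⟨hx.symm.le, h⟩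
      · exact h1 ⟨hx, h⟩
    rw [abs_of_nonneg (by positivity), sq2]
    have := exp_cross Dp Dm t x (-y) (y - x) m hDp hDm ht hm1 hm2 hm hx
      (neg_nonneg.2 hy) (by ring)
    rw [show (x * √Dm + -y * √Dp) ^ 2 = (y * √Dp - x * √Dm) ^ 2 by ring] at this
    calc _ ≤ 2 / (√Dp + √Dm) * (√(2 * π) * √t)⁻¹ * Real.exp (-m * ((y - x) ^ 2 / t)) := by gcongr
      _ = _ := by simp only [K3]; rw [mul_inv]; ring

theorem sqrt_tendsto_aux : Tendsto (fun t : ℝ => √t) (𝓝[>] 0) (𝓝 0) := by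
  have := (Real.continuous_sqrt.tendsto 0).mono_left (nhdsWithin_le_nhds (s := Set.Ioi 0))
  simpa using this

/-- The reflected term vanishes in the limit. -/
theorem refl_lim (D c x z : ℝ) (hD : 0 < D) (hx : x ≠ 0) :
    Tendsto (fun t => (√(2 * π * D))⁻¹ *
      (Real.exp (-z ^ 2 / (2 * D)) + c * Real.exp (-(x + √t * z + x) ^ 2 / (2 * D * t)))) (𝓝[>] 0)
      (𝓝 ((√(2 * π * D))⁻¹ * Real.exp (-z ^ 2 / (2 * D)))) := by
  have h1 : Tendsto (fun t : ℝ => (x + √t * z + x) ^ 2 / (2 * D)) (𝓝[>] 0)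
      (𝓝 ((x + 0 * z + x) ^ 2 / (2 * D))) :=
    ((((sqrt_tendsto_aux.mul_const z).const_add x).add_const x).pow 2).div_const _
  have hpos : 0 < (x + 0 * z + x) ^ 2 / (2 * D) := by
    have : x + 0 * z + x ≠ 0 := by
      intro h; apply hx; linarith
    positivity
  have h2 := h1.pos_mul_atTop hpos tendsto_inv_nhdsGT_zero
  have h3 := Real.tendsto_exp_neg_atTop_nhds_zero.comp h2
  have h4 := ((h3.const_mul c).const_add (Real.exp (-z ^ 2 / (2 * D)))).const_mul
    (√(2 * π * D))⁻¹
  rw [mul_zero, add_zero] at h4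
  refine h4.congr fun t => ?_
  simp only [Function.comp]
  congr 4
  rw [neg_div, ← div_eq_mul_inv _ t, div_div]

theorem gauss_one (D : ℝ) (hD : 0 < D) :
    ∫ z, (√(2 * π * D))⁻¹ * Real.exp (-z ^ 2 / (2 * D)) = 1 := by
  have h := integral_gaussian (1 / (2 * D))
  have e : ∀ z : ℝ, -z ^ 2 / (2 * D) = -(1 / (2 * D)) * z ^ 2 := fun z => by ring
  simp_rw [e]
  rw [integral_const_mul, h, show π / (1 / (2 * D)) = 2 * π * D by field_simp]
  exact inv_mul_cancel₀ (by positivity)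

theorem gauss_Ioi (D : ℝ) (hD : 0 < D) :
    ∫ z in Set.Ioi (0:ℝ), Real.exp (-z ^ 2 / (2 * D)) = √(2 * π) * √D / 2 := by
  have h := integral_gaussian_Ioi (1 / (2 * D))
  have e : ∀ z : ℝ, -z ^ 2 / (2 * D) = -(1 / (2 * D)) * z ^ 2 := fun z => by ring
  simp_rw [e]
  rw [h, show π / (1 / (2 * D)) = 2 * π * D by field_simp, Real.sqrt_mul (by positivity)]

theorem gauss_Iic (D : ℝ) (hD : 0 < D) :
    ∫ z in Set.Iic (0:ℝ), Real.exp (-z ^ 2 / (2 * D)) = √(2 * π) * √D / 2 := by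
  rw [← gauss_Ioi D hD]
  have := integral_comp_neg_Iic (0:ℝ) (fun z : ℝ => Real.exp (-z ^ 2 / (2 * D)))
  simpa using this

theorem gauss_int (D : ℝ) (hD : 0 < D) : Integrable fun z : ℝ => Real.exp (-z ^ 2 / (2 * D)) := by
  have e : ∀ z : ℝ, -z ^ 2 / (2 * D) = -(1 / (2 * D)) * z ^ 2 := fun z => by ring
  simp_rw [e]
  exact integrable_exp_neg_mul_sq (by positivity)

theorem skew_one (Dp Dm : ℝ) (hDp : 0 < Dp) (hDm : 0 < Dm) :
    ∫ z : ℝ, (2 / (√Dp + √Dm) * (√(2 * π))⁻¹) * (if 0 < z then Real.exp (-z ^ 2 / (2 * Dp)) else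
      Real.exp (-z ^ 2 / (2 * Dm))) = 1 := by
  have hap := Real.sqrt_pos.2 hDp
  have hbp := Real.sqrt_pos.2 hDm
  rw [integral_const_mul]
  have hi : ∫ z : ℝ, (if 0 < z then Real.exp (-z ^ 2 / (2 * Dp)) else
      Real.exp (-z ^ 2 / (2 * Dm))) = √(2 * π) * √Dp / 2 + √(2 * π) * √Dm / 2 := by
    have := integral_piecewise (μ := volume) (measurableSet_Ioi (a := (0:ℝ)))
      (gauss_int Dp hDp).integrableOn (gauss_int Dm hDm).integrableOn
    rw [Set.compl_Ioi, gauss_Ioi Dp hDp, gauss_Iic Dm hDm] at this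
    rw [← this]
    rfl
  have : 0 < √(2 * π) := by positivity
  rw [hi]
  field_simp

/-- the physical skew diffusion density attains the initial
condition as `t → 0⁺`, for every bounded continuous initial datum. -/
theorem pStar_initial_condition (Dp Dm : ℝ) (hDp : 0 < Dp) (hDm : 0 < Dm)
    (u₀ : ℝ → ℝ) (hcont : Continuous u₀) (hbdd : ∃ M : ℝ, ∀ y : ℝ, |u₀ y| ≤ M)
    (x : ℝ) :
    Filter.Tendsto (fun t : ℝ => ∫ y : ℝ, pStar Dp Dm t x y * u₀ y)
      (nhdsWithin 0 (Set.Ioi 0)) (nhds (u₀ x)) := by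
  obtain ⟨C, m, hm, hb⟩ := pStar_bound Dp Dm hDp hDm x
  have hx0 : ∀ z : ℝ, Tendsto (fun t : ℝ => x + √t * z) (𝓝[>] 0) (𝓝 x) := fun z => by
    simpa using (sqrt_tendsto_aux.mul_const z).const_add x
  have main := fun G hlim hG => approx_id_aux (fun t y => pStar Dp Dm t x y) x C m hm G
    (fun t => pStar_meas Dp Dm t x) hb hlim hG u₀ hcont hbdd
  have e1 : ∀ D t z : ℝ, 0 < t → -(x + √t * z - x) ^ 2 / (2 * D * t) = -z ^ 2 / (2 * D) := by
    intro D t z ht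
    rw [add_sub_cancel_left, mul_pow, Real.sq_sqrt ht.le]
    rw [show -(t * z ^ 2) = -z ^ 2 * t by ring, mul_div_mul_right _ _ ht.ne']
  have e2 : ∀ D t w : ℝ, 0 < D → 0 < t →
      √t * ((√(2 * π * D * t))⁻¹ * w) = (√(2 * π * D))⁻¹ * w := by
    intro D t w hD ht
    have hst : 0 < √t := Real.sqrt_pos.2 ht
    rw [Real.sqrt_mul (by positivity) t]
    field_simp
  rcases lt_trichotomy x 0 with hx | hx | hx
  · refine main (fun z => (√(2 * π * Dm))⁻¹ * Real.exp (-z ^ 2 / (2 * Dm))) (fun z => ?_)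
      (gauss_one Dm hDm)
    refine (refl_lim Dm (-((√Dp - √Dm) / (√Dp + √Dm))) x z hDm hx.ne).congr' ?_
    filter_upwards [self_mem_nhdsWithin, (hx0 z).eventually (gt_mem_nhds hx)] with t ht hy
    have ht' : 0 < t := ht
    simp only [pStar]
    rw [if_neg (fun h => absurd h.1 hx.le.not_gt), if_pos ⟨hx, hy.le⟩, e2 _ _ _ hDm ht',
      e1 _ _ _ ht', neg_mul, ← sub_eq_add_neg]
  · subst hx
    refine main _ (fun z => ?_) (skew_one Dp Dm hDp hDm)
    refine tendsto_const_nhds.congr' ?_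
    filter_upwards [self_mem_nhdsWithin] with t ht
    have ht' : 0 < t := ht
    have hst : 0 < √t := Real.sqrt_pos.2 ht'
    have hap := Real.sqrt_pos.2 hDp
    have hbp := Real.sqrt_pos.2 hDm
    have e3 : ∀ k w : ℝ, √t * (k * (√(2 * π * t))⁻¹ * w) = k * (√(2 * π))⁻¹ * w := by
      intro k w
      rw [Real.sqrt_mul (by positivity) t]
      field_simp
    have hz : (0 < 0 + √t * z) ↔ 0 < z := by
      rw [zero_add]; exact mul_pos_iff_of_pos_left hst
    simp only [pStar, lt_irrefl, false_and, if_false, le_refl, true_and, hz]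
    split_ifs with h
    · rw [e3]
      congr 2
      rw [zero_add, zero_mul, sub_zero, mul_pow, mul_pow, Real.sq_sqrt ht'.le, Real.sq_sqrt hDm.le]
      field_simp
    · rw [e3]
      congr 2
      rw [zero_add, zero_mul, sub_zero, mul_pow, mul_pow, Real.sq_sqrt ht'.le, Real.sq_sqrt hDp.le]
      field_simp
  · refine main (fun z => (√(2 * π * Dp))⁻¹ * Real.exp (-z ^ 2 / (2 * Dp))) (fun z => ?_)
      (gauss_one Dp hDp)
    refine (refl_lim Dp ((√Dp - √Dm) / (√Dp + √Dm)) x z hDp hx.ne').congr' ?_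
    filter_upwards [self_mem_nhdsWithin, (hx0 z).eventually (lt_mem_nhds hx)] with t ht hy
    have ht' : 0 < t := ht
    simp only [pStar]
    rw [if_pos ⟨hx, hy⟩, e2 _ _ _ hDp ht', e1 _ _ _ ht']
end

section
/- The skew Brownian motion transition density satisfies the Chapman–Kolmogorov (semigroup) equations: for all s > 0, t > 0 and all x, y ∈ ℝ, ∫_ℝ p^{(α)}(s,x,z)·p^{(α)}(t,z,y) dz = p^{(α)}(s+t,x,y). -/
open MeasureTheory Real Filter Topology

/-- The Gaussian heat kernel on `ℝ`. -/
noncomputable def gaussKernel (t z : ℝ) : ℝ :=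
  (Real.sqrt (2 * Real.pi * t))⁻¹ * Real.exp (-z ^ 2 / (2 * t))

/-- The transition density of `α`-skew Brownian motion. -/
noncomputable def pSkew (α t x y : ℝ) : ℝ :=
  if 0 < x ∧ 0 < y then gaussKernel t (y - x) + (2 * α - 1) * gaussKernel t (y + x)
  else if x < 0 ∧ y ≤ 0 then gaussKernel t (y - x) - (2 * α - 1) * gaussKernel t (y + x)
  else if x ≤ 0 ∧ 0 < y then 2 * α * gaussKernel t (y - x)
  else 2 * (1 - α) * gaussKernel t (y - x)

lemma gk_cont (t : ℝ) : Continuous (gaussKernel t) := by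
  unfold gaussKernel; fun_prop

lemma gk_neg (t z : ℝ) : gaussKernel t (-z) = gaussKernel t z := by
  simp [gaussKernel]

lemma gk_abs (t z : ℝ) : gaussKernel t |z| = gaussKernel t z := by
  simp [gaussKernel]

lemma gk_nonneg (t z : ℝ) : 0 ≤ gaussKernel t z := by
  unfold gaussKernel; positivity

lemma gk_mono {t : ℝ} (ht : 0 < t) {u v : ℝ} (h : |u| ≤ |v|) :
    gaussKernel t v ≤ gaussKernel t u := by
  have h2 : u ^ 2 ≤ v ^ 2 := sq_le_sq.2 h
  unfold gaussKernel
  gcongr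

lemma gk_integrable {t : ℝ} (ht : 0 < t) : Integrable (gaussKernel t) := by
  have h := (integrable_exp_neg_mul_sq (b := 1 / (2 * t)) (by positivity)).const_mul
    (Real.sqrt (2 * Real.pi * t))⁻¹
  refine h.congr (Eventually.of_forall fun z => ?_)
  simp only [gaussKernel]
  congr 2
  ring

lemma gk_integral {t : ℝ} (ht : 0 < t) : ∫ z, gaussKernel t z = 1 := by
  have h := integral_gaussian (1 / (2 * t))
  have e : ∀ z, gaussKernel t z =
      (Real.sqrt (2 * Real.pi * t))⁻¹ * Real.exp (-(1 / (2 * t)) * z ^ 2) := by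
    intro z
    simp only [gaussKernel]
    congr 2
    ring
  simp_rw [e]
  rw [integral_const_mul, h]
  have : π / (1 / (2 * t)) = 2 * π * t := by field_simp
  rw [this]
  exact inv_mul_cancel₀ (by positivity)

lemma gk_mul {s t : ℝ} (hs : 0 < s) (ht : 0 < t) (x y z : ℝ) :
    gaussKernel s (z - x) * gaussKernel t (y - z) =
      gaussKernel (s + t) (y - x) *
        gaussKernel (s * t / (s + t)) (z - (t * x + s * y) / (s + t)) := by
  unfold gaussKernel
  rw [mul_mul_mul_comm, mul_mul_mul_comm (√(2 * π * (s + t)))⁻¹, ← Real.exp_add, ← Real.exp_add, ← mul_inv, ← mul_inv,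
    ← Real.sqrt_mul (by positivity), ← Real.sqrt_mul (by positivity)]
  congr 2
  · congr 1
    field_simp
  · field_simp
    ring

lemma gk_conv {s t : ℝ} (hs : 0 < s) (ht : 0 < t) (x y : ℝ) :
    ∫ z, gaussKernel s (z - x) * gaussKernel t (y - z) = gaussKernel (s + t) (y - x) := by
  simp_rw [gk_mul hs ht]
  rw [integral_const_mul, integral_sub_right_eq_self (gaussKernel (s * t / (s + t))),
    gk_integral (by positivity), mul_one]

lemma gk_conv_integrable {s t : ℝ} (hs : 0 < s) (ht : 0 < t) (x y : ℝ) :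
    Integrable fun z => gaussKernel s (z - x) * gaussKernel t (y - z) := by
  simp_rw [gk_mul hs ht]
  exact ((gk_integrable (t := s * t / (s + t)) (by positivity)).comp_sub_right _).const_mul _

/-- A sign that is `-1` at the origin. -/
noncomputable def sg (y : ℝ) : ℝ := if 0 < y then 1 else -1

lemma pSkew_eq (α t x y : ℝ) : pSkew α t x y =
    gaussKernel t (y - x) + (2 * α - 1) * sg y * gaussKernel t (|x| + |y|) := by
  unfold pSkew sg
  rcases lt_trichotomy x 0 with hx | hx | hx <;> rcases le_or_gt y 0 with hy | hy
  · have e : |x| + |y| = -(y + x) := by rw [abs_of_neg hx, abs_of_nonpos hy]; ring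
    simp only [hx, hy, not_lt.2 hy, and_false, if_false, and_self, if_true, e, gk_neg]
    ring
  · have e : |x| + |y| = y - x := by rw [abs_of_neg hx, abs_of_pos hy]; ring
    simp only [hx.le, hy, not_lt.2 hx.le, not_le.2 hy, false_and, and_false, if_false, and_self,
      if_true, e]
    ring
  · subst hx
    simp only [lt_irrefl, not_lt.2 hy, and_false, false_and, if_false, abs_zero, zero_add, gk_abs,
      sub_zero]
    ring
  · subst hx
    simp only [lt_irrefl, hy, le_refl, and_self, false_and, if_false, if_true, abs_zero, zero_add,
      gk_abs, sub_zero]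
    ring
  · have e : |x| + |y| = -(y - x) := by rw [abs_of_pos hx, abs_of_nonpos hy]; ring
    simp only [not_lt.2 hx.le, not_lt.2 hy, and_false, false_and, if_false, e, gk_neg]
    ring
  · have e : |x| + |y| = y + x := by rw [abs_of_pos hx, abs_of_pos hy]; ring
    simp only [hx, hy, and_self, if_true, e]
    ring

lemma sg_meas : Measurable sg :=
  Measurable.ite measurableSet_Ioi measurable_const measurable_const

lemma sg_abs (y : ℝ) : |sg y| = 1 := by unfold sg; split_ifs <;> simp

lemma pSkew_integrable {s t : ℝ} (hs : 0 < s) (ht : 0 < t) (α x y : ℝ) :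
    Integrable fun z => pSkew α s x z * pSkew α t z y := by
  simp_rw [pSkew_eq]
  have m := sg_meas
  have c1 := gk_cont s
  have c2 := gk_cont t
  have h1 : Integrable fun z => gaussKernel s (z - x) := (gk_integrable hs).comp_sub_right x
  refine Integrable.mul_bdd (c := gaussKernel t 0 + |2 * α - 1| * gaussKernel t 0) ?_ ?_ ?_
  · refine h1.add (h1.const_mul |2 * α - 1| |>.mono' ?_ ?_)
    · have c3 : Measurable fun z => gaussKernel s (|x| + |z|) :=
        (c1.comp (by fun_prop : Continuous fun z : ℝ => |x| + |z|)).measurable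
      exact ((m.const_mul _).mul c3).aestronglyMeasurable
    · refine Eventually.of_forall fun z => ?_
      rw [Real.norm_eq_abs, abs_mul, abs_mul, sg_abs, mul_one, abs_of_nonneg (gk_nonneg _ _)]
      gcongr
      apply gk_mono hs
      rw [abs_of_nonneg (by positivity : 0 ≤ |x| + |z|), add_comm]
      exact abs_sub z x
  · apply Continuous.aestronglyMeasurable
    fun_prop
  · refine Eventually.of_forall fun z => ?_
    refine (norm_add_le _ _).trans ?_
    rw [Real.norm_eq_abs, Real.norm_eq_abs, abs_mul, abs_mul, sg_abs, mul_one,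
      abs_of_nonneg (gk_nonneg _ _), abs_of_nonneg (gk_nonneg _ _)]
    gcongr <;> exact gk_mono ht (by simp)

/-- The symmetrised integrands agree away from the origin. -/
lemma fold_eq (α s t x y z : ℝ) (hz : 0 < z) :
    pSkew α s x z * pSkew α t z y + pSkew α s x (-z) * pSkew α t (-z) y =
    (gaussKernel s (z - x) * gaussKernel t (y - z) + (2 * α - 1) * sg y *
      (gaussKernel s (z - -|x|) * gaussKernel t (|y| - z))) +
    (gaussKernel s (-z - x) * gaussKernel t (y - -z) + (2 * α - 1) * sg y *
      (gaussKernel s (-z - -|x|) * gaussKernel t (|y| - -z))) := by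
  simp_rw [pSkew_eq]
  have s1 : sg z = 1 := by simp [sg, hz]
  have s2 : sg (-z) = -1 := by simp [sg, hz.le]
  rw [s1, s2, abs_neg, abs_of_pos hz]
  have a1 : gaussKernel s (z - -|x|) = gaussKernel s (|x| + z) := by congr 1; ring
  have a2 : gaussKernel t (|y| - -z) = gaussKernel t (z + |y|) := by congr 1; ring
  have a3 : gaussKernel s (-z - -|x|) = gaussKernel s (z - |x|) := by
    rw [← gk_neg]; congr 1; ring
  have a4 : gaussKernel s (-z - x) = gaussKernel s (z + x) := by
    rw [← gk_neg]; congr 1; ring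
  have b1 : gaussKernel s (z - x) + gaussKernel s (z + x) =
      gaussKernel s (z - |x|) + gaussKernel s (|x| + z) := by
    rcases abs_cases x with ⟨h, _⟩ | ⟨h, _⟩ <;> rw [h]
    · rw [add_comm x z]
    · rw [sub_neg_eq_add, neg_add_eq_sub, add_comm]
  have b2 : gaussKernel t (y - z) - gaussKernel t (y - -z) =
      sg y * (gaussKernel t (|y| - z) - gaussKernel t (z + |y|)) := by
    unfold sg
    split_ifs with h
    · rw [abs_of_pos h, sub_neg_eq_add, add_comm y z, one_mul]
    · rw [abs_of_nonpos (not_lt.1 h), ← gk_neg t (-y - z), ← gk_neg t (z + -y)]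
      have e1 : -(-y - z) = y - -z := by ring
      have e2 : -(z + -y) = y - z := by ring
      rw [e1, e2]; ring
  rw [a1, a2, a3, a4]
  linear_combination (2 * α - 1) * sg y * gaussKernel t (z + |y|) * b1 +
    (2 * α - 1) * gaussKernel s (|x| + z) * b2

/-- Chapman–Kolmogorov equations for the `α`-skew Brownian
motion transition density. -/
theorem pSkew_chapman_kolmogorov (α : ℝ) (hα₀ : 0 < α) (hα₁ : α < 1)
    (s t : ℝ) (hs : 0 < s) (ht : 0 < t) (x y : ℝ) :
    ∫ z : ℝ, pSkew α s x z * pSkew α t z y = pSkew α (s + t) x y := by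
  set F : ℝ → ℝ := fun z => pSkew α s x z * pSkew α t z y with hF
  set G : ℝ → ℝ := fun z => gaussKernel s (z - x) * gaussKernel t (y - z) + (2 * α - 1) * sg y *
      (gaussKernel s (z - -|x|) * gaussKernel t (|y| - z)) with hG
  have iF : Integrable F := pSkew_integrable hs ht α x y
  have i1 := gk_conv_integrable hs ht x y
  have i2 := (gk_conv_integrable hs ht (-|x|) |y|).const_mul ((2 * α - 1) * sg y)
  have iG : Integrable G := i1.add i2
  have key : ∫ z, (F z + F (-z)) = ∫ z, (G z + G (-z)) := by
    apply integral_congr_ae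
    have h0 : ∀ᵐ z : ℝ, z ≠ 0 := by simp [ae_iff]
    filter_upwards [h0] with z hz
    rcases lt_or_gt_of_ne hz with h | h
    · have := fold_eq α s t x y (-z) (by linarith)
      rw [neg_neg] at this
      rw [add_comm (F z), add_comm (G z)]
      exact this
    · exact fold_eq α s t x y z h
  rw [integral_add iF iF.comp_neg, integral_add iG iG.comp_neg, integral_neg_eq_self F,
    integral_neg_eq_self G] at key
  have hGi : ∫ z, G z = pSkew α (s + t) x y := by
    rw [hG, integral_add i1 i2, integral_const_mul, gk_conv hs ht, gk_conv hs ht, pSkew_eq,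
      sub_neg_eq_add, add_comm |y|]
  linarith
end

section
/- Fix y ≠ 0. In the backward variable, the skew Brownian motion density solves the heat equation with the α-skew interface condition: (i) for every t > 0 and every x ≠ 0, ∂p^{(α)}/∂t (t,x,y) = (1/2)·∂²p^{(α)}/∂x² (t,x,y); (ii) for every t > 0, lim_{x↓0} p^{(α)}(t,x,y) = lim_{x↑0} p^{(α)}(t,x,y); (iii) for every t > 0, α·lim_{x↓0} ∂p^{(α)}/∂x (t,x,y) = (1−α)·lim_{x↑0} ∂p^{(α)}/∂x (t,x,y). -/
open MeasureTheory Real Filter Topology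

/-- Derivative of the heat kernel in space. -/
lemma gk_hasDerivAt_space (t z : ℝ) (ht : 0 < t) :
    HasDerivAt (fun z => gaussKernel t z) (-(z / t) * gaussKernel t z) z := by
  unfold gaussKernel
  have h1 : HasDerivAt (fun z : ℝ => -z ^ 2 / (2 * t)) (-(z / t)) z := by
    have := ((hasDerivAt_pow 2 z).neg).div_const (2 * t)
    refine this.congr_deriv ?_
    field_simp
    simp
  refine (h1.exp.const_mul _).congr_deriv ?_
  ring

/-- Derivative of the heat kernel in time. -/
lemma gk_hasDerivAt_time (t z : ℝ) (ht : 0 < t) :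
    HasDerivAt (fun s => gaussKernel s z)
      ((1 / 2) * ((z ^ 2 / t ^ 2 - 1 / t) * gaussKernel t z)) t := by
  unfold gaussKernel
  have hpos : 0 < 2 * π * t := by positivity
  have h1 : HasDerivAt (fun s : ℝ => -z ^ 2 / (2 * s)) (z ^ 2 / (2 * t ^ 2)) t := by
    have := (hasDerivAt_const t (-z ^ 2)).div ((hasDerivAt_id t).const_mul 2)
      (by simpa using ht.ne')
    refine this.congr_deriv ?_
    simp only [id]
    field_simp
    ring
  have h2 : HasDerivAt (fun s : ℝ => (√(2 * π * s))⁻¹)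
      (-(1 / (2 * t)) * (√(2 * π * t))⁻¹) t := by
    have h3 := (((hasDerivAt_id t).const_mul (2 * π)).sqrt hpos.ne').inv
      (Real.sqrt_pos.mpr hpos).ne'
    refine h3.congr_deriv ?_
    simp only [id]
    have hs : √(2 * π * t) ≠ 0 := (Real.sqrt_pos.mpr hpos).ne'
    rw [Real.sq_sqrt hpos.le]
    field_simp
  refine (h2.mul h1.exp).congr_deriv ?_
  field_simp
  ring

/-- Combination of the kernel and its reflection. -/
noncomputable def gkComb (y A B t x : ℝ) : ℝ :=
  A * gaussKernel t (y - x) + B * gaussKernel t (y + x)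

/-- Space derivative of the combination. -/
noncomputable def gkComb1 (y A B t x : ℝ) : ℝ :=
  A * ((y - x) / t * gaussKernel t (y - x)) - B * ((y + x) / t * gaussKernel t (y + x))

/-- Second space derivative of the combination. -/
noncomputable def gkComb2 (y A B t x : ℝ) : ℝ :=
  A * (((y - x) ^ 2 / t ^ 2 - 1 / t) * gaussKernel t (y - x)) +
    B * (((y + x) ^ 2 / t ^ 2 - 1 / t) * gaussKernel t (y + x))

lemma gk_sub (y t x : ℝ) (ht : 0 < t) :
    HasDerivAt (fun x => gaussKernel t (y - x)) ((y - x) / t * gaussKernel t (y - x)) x := by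
  refine ((gk_hasDerivAt_space t (y - x) ht).comp x ((hasDerivAt_id x).const_sub y)).congr_deriv ?_
  ring

lemma gk_add (y t x : ℝ) (ht : 0 < t) :
    HasDerivAt (fun x => gaussKernel t (y + x)) (-((y + x) / t) * gaussKernel t (y + x)) x := by
  refine ((gk_hasDerivAt_space t (y + x) ht).comp x ((hasDerivAt_id x).const_add y)).congr_deriv ?_
  ring

lemma gkComb_deriv (y A B t x : ℝ) (ht : 0 < t) :
    HasDerivAt (gkComb y A B t) (gkComb1 y A B t x) x := by
  refine (((gk_sub y t x ht).const_mul A).add ((gk_add y t x ht).const_mul B)).congr_deriv ?_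
  unfold gkComb1
  ring

lemma gkComb1_deriv (y A B t x : ℝ) (ht : 0 < t) :
    HasDerivAt (gkComb1 y A B t) (gkComb2 y A B t x) x := by
  have h1 := ((((hasDerivAt_id x).const_sub y).div_const t).mul (gk_sub y t x ht)).const_mul A
  have h2 := ((((hasDerivAt_id x).const_add y).div_const t).mul (gk_add y t x ht)).const_mul B
  refine (h1.sub h2).congr_deriv ?_
  unfold gkComb2
  simp only [id]
  field_simp
  ring

lemma gkComb_time (y A B t x : ℝ) (ht : 0 < t) :
    HasDerivAt (fun s => gkComb y A B s x) ((1 / 2) * gkComb2 y A B t x) t := by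
  refine (((gk_hasDerivAt_time t (y - x) ht).const_mul A).add
    ((gk_hasDerivAt_time t (y + x) ht).const_mul B)).congr_deriv ?_
  unfold gkComb2
  ring

/-- Everything that is needed on one open side `S` of the interface. -/
lemma side_facts (α y A B : ℝ) (S : Set ℝ) (hS : IsOpen S)
    (h : ∀ t, ∀ x ∈ S, pSkew α t x y = gkComb y A B t x) (t : ℝ) (ht : 0 < t) :
    (∀ x ∈ S, deriv (fun s : ℝ => pSkew α s x y) t =
        (1 / 2) * deriv (deriv (fun x' : ℝ => pSkew α t x' y)) x) ∧
    Tendsto (fun x : ℝ => pSkew α t x y) (𝓝[S] 0) (𝓝 ((A + B) * gaussKernel t y)) ∧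
    Tendsto (deriv (fun x' : ℝ => pSkew α t x' y)) (𝓝[S] 0)
      (𝓝 ((A - B) * (y / t * gaussKernel t y))) := by
  have hd : ∀ x ∈ S, deriv (fun x' : ℝ => pSkew α t x' y) x = gkComb1 y A B t x := by
    intro x hx
    have : (fun x' : ℝ => pSkew α t x' y) =ᶠ[𝓝 x] gkComb y A B t := by
      filter_upwards [hS.mem_nhds hx] with z hz using h t z hz
    rw [this.deriv_eq, (gkComb_deriv y A B t x ht).deriv]
  refine ⟨?_, ?_, ?_⟩
  · intro x hx
    have h1 : (fun s : ℝ => pSkew α s x y) = fun s => gkComb y A B s x := by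
      funext s
      exact h s x hx
    have h2 : deriv (fun x' : ℝ => pSkew α t x' y) =ᶠ[𝓝 x] gkComb1 y A B t := by
      filter_upwards [hS.mem_nhds hx] with z hz using hd z hz
    rw [h1, h2.deriv_eq, (gkComb1_deriv y A B t x ht).deriv, (gkComb_time y A B t x ht).deriv]
  · have h1 := (gkComb_deriv y A B t 0 ht).continuousAt.continuousWithinAt (s := S)
    have h2 : gkComb y A B t 0 = (A + B) * gaussKernel t y := by
      unfold gkComb
      simp only [sub_zero, add_zero]
      ring
    have h3 : Tendsto (gkComb y A B t) (𝓝[S] 0) (𝓝 (gkComb y A B t 0)) := h1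
    rw [h2] at h3
    refine h3.congr' ?_
    filter_upwards [self_mem_nhdsWithin] with z hz using (h t z hz).symm
  · have h1 := (gkComb1_deriv y A B t 0 ht).continuousAt.continuousWithinAt (s := S)
    have h2 : gkComb1 y A B t 0 = (A - B) * (y / t * gaussKernel t y) := by
      unfold gkComb1
      simp only [sub_zero, add_zero]
      ring
    have h3 : Tendsto (gkComb1 y A B t) (𝓝[S] 0) (𝓝 (gkComb1 y A B t 0)) := h1
    rw [h2] at h3
    refine h3.congr' ?_
    filter_upwards [self_mem_nhdsWithin] with z hz using (hd z hz).symm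

lemma coeffs (α y : ℝ) (hy : y ≠ 0) : ∃ A B C D : ℝ,
    (∀ t, ∀ x ∈ Set.Ioi (0 : ℝ), pSkew α t x y = gkComb y A B t x) ∧
    (∀ t, ∀ x ∈ Set.Iio (0 : ℝ), pSkew α t x y = gkComb y C D t x) ∧
    A + B = C + D ∧ α * (A - B) = (1 - α) * (C - D) := by
  rcases lt_or_gt_of_ne hy with h | h
  · refine ⟨2 * (1 - α), 0, 1, -(2 * α - 1), ?_, ?_, by ring, by ring⟩
    · intro t x hx
      have hx : 0 < x := hx
      simp [pSkew, gkComb, h.not_gt, hx.not_gt]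
    · intro t x hx
      have hx : x < 0 := hx
      simp only [pSkew, gkComb, h.not_gt, hx, h.le, and_self, and_false, if_true, if_false]
      ring
  · refine ⟨1, 2 * α - 1, 2 * α, 0, ?_, ?_, by ring, by ring⟩
    · intro t x hx
      have hx : 0 < x := hx
      simp [pSkew, gkComb, h, hx]
    · intro t x hx
      have hx : x < 0 := hx
      simp [pSkew, gkComb, h, h.not_ge, hx.not_gt, hx.le]

/-- for fixed `y ≠ 0`, in the backward variable the skew
Brownian motion density solves the heat equation together with the `α`-skew
interface condition at the origin. -/
theorem pSkew_backward_interface_problem (α : ℝ) (hα₀ : 0 < α) (hα₁ : α < 1)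
    (y : ℝ) (hy : y ≠ 0) :
    (∀ t : ℝ, 0 < t → ∀ x : ℝ, x ≠ 0 →
      deriv (fun s : ℝ => pSkew α s x y) t =
        (1 / 2) * deriv (deriv (fun x' : ℝ => pSkew α t x' y)) x) ∧
    (∀ t : ℝ, 0 < t → ∃ c : ℝ,
      Filter.Tendsto (fun x : ℝ => pSkew α t x y)
        (nhdsWithin 0 (Set.Ioi 0)) (nhds c) ∧
      Filter.Tendsto (fun x : ℝ => pSkew α t x y)
        (nhdsWithin 0 (Set.Iio 0)) (nhds c)) ∧
    (∀ t : ℝ, 0 < t → ∃ gp gm : ℝ,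
      Filter.Tendsto (deriv (fun x' : ℝ => pSkew α t x' y))
        (nhdsWithin 0 (Set.Ioi 0)) (nhds gp) ∧
      Filter.Tendsto (deriv (fun x' : ℝ => pSkew α t x' y))
        (nhdsWithin 0 (Set.Iio 0)) (nhds gm) ∧
      α * gp = (1 - α) * gm) := by
  obtain ⟨A, B, C, D, hp, hm, h1, h2⟩ := coeffs α y hy
  refine ⟨?_, ?_, ?_⟩
  · intro t ht x hx
    rcases lt_or_gt_of_ne hx with h | h
    · exact (side_facts α y C D _ isOpen_Iio hm t ht).1 x h
    · exact (side_facts α y A B _ isOpen_Ioi hp t ht).1 x h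
  · intro t ht
    refine ⟨_, (side_facts α y A B _ isOpen_Ioi hp t ht).2.1, ?_⟩
    rw [h1]
    exact (side_facts α y C D _ isOpen_Iio hm t ht).2.1
  · intro t ht
    refine ⟨_, _, (side_facts α y A B _ isOpen_Ioi hp t ht).2.2,
      (side_facts α y C D _ isOpen_Iio hm t ht).2.2, ?_⟩
    rw [← mul_assoc, h2, mul_assoc]
end

section
/- The physical skew diffusion is a rescaled skew Brownian motion with transmission parameter α* := √D⁺/(√D⁺+√D⁻): for all t > 0 and all x, y ∈ ℝ, p*(t,x,y) = p^{(α*)}(t, s⁻¹(x), s⁻¹(y)) / √(D(y)). -/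
open MeasureTheory Real Filter Topology

/-- The piecewise constant diffusion coefficient: `D⁺` for `x > 0`,
`D⁻` for `x ≤ 0`. -/
noncomputable def Dcoef (Dp Dm x : ℝ) : ℝ := if 0 < x then Dp else Dm

/-- The inverse of the rescaling map `s_{√D}`:
`s⁻¹(x) = x / √D⁺` for `x > 0` and `x / √D⁻` for `x ≤ 0`. -/
noncomputable def sInv (Dp Dm x : ℝ) : ℝ :=
  if 0 < x then x / Real.sqrt Dp else x / Real.sqrt Dm

/-- the physical skew diffusion is the rescaling of skew
Brownian motion with transmission parameter `α* = √D⁺/(√D⁺ + √D⁻)`. -/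
theorem pStar_eq_rescaled_pSkew (Dp Dm : ℝ) (hDp : 0 < Dp) (hDm : 0 < Dm)
    (t : ℝ) (ht : 0 < t) (x y : ℝ) :
    pStar Dp Dm t x y =
      pSkew (Real.sqrt Dp / (Real.sqrt Dp + Real.sqrt Dm)) t
        (sInv Dp Dm x) (sInv Dp Dm y) / Real.sqrt (Dcoef Dp Dm y) := by
  obtain ⟨a, ha, rfl⟩ : ∃ a : ℝ, 0 < a ∧ Dp = a ^ 2 :=
    ⟨Real.sqrt Dp, Real.sqrt_pos.2 hDp, (Real.sq_sqrt hDp.le).symm⟩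
  obtain ⟨b, hb, rfl⟩ : ∃ b : ℝ, 0 < b ∧ Dm = b ^ 2 :=
    ⟨Real.sqrt Dm, Real.sqrt_pos.2 hDm, (Real.sq_sqrt hDm.le).symm⟩
  have hs : 0 < Real.sqrt (2 * Real.pi * t) := Real.sqrt_pos.2 (by positivity)
  have hsc : ∀ c : ℝ, 0 < c →
      Real.sqrt (2 * Real.pi * c ^ 2 * t) = c * Real.sqrt (2 * Real.pi * t) := by
    intro c hc
    rw [show 2 * Real.pi * c ^ 2 * t = c ^ 2 * (2 * Real.pi * t) by ring,
      Real.sqrt_mul (by positivity), Real.sqrt_sq hc.le]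
  have hab : a + b ≠ 0 := by positivity
  unfold pStar pSkew sInv Dcoef gaussKernel
  rw [hsc a ha, hsc b hb, Real.sqrt_sq ha.le, Real.sqrt_sq hb.le]
  generalize Real.sqrt (2 * Real.pi * t) = S at hs
  rcases lt_or_ge 0 x with hx | hx <;> rcases lt_or_ge 0 y with hy | hy
  · have h1 : 0 < x / a := by positivity
    have h2 : 0 < y / a := by positivity
    simp only [hx, hy, h1, h2, and_self, if_true, Real.sqrt_sq ha.le]
    rw [show -(y / a - x / a) ^ 2 / (2 * t) = -(y - x) ^ 2 / (2 * a ^ 2 * t) by field_simp,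
      show -(y / a + x / a) ^ 2 / (2 * t) = -(y + x) ^ 2 / (2 * a ^ 2 * t) by field_simp]
    field_simp
    ring
  · have h1 : 0 < x / a := by positivity
    have h2 : y / b ≤ 0 := div_nonpos_of_nonpos_of_nonneg hy hb.le
    simp only [hx, hy.not_gt, h1, h2.not_gt, hx.not_gt, h1.not_gt, hx.not_ge, h1.not_ge,
      and_false, false_and, if_true, if_false, Real.sqrt_sq hb.le]
    rw [show -(y / b - x / a) ^ 2 / (2 * t)
      = -(y * a - x * b) ^ 2 / (2 * a ^ 2 * b ^ 2 * t) by field_simp]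
    field_simp
    ring
  · have h1 : x / b ≤ 0 := div_nonpos_of_nonpos_of_nonneg hx hb.le
    have h2 : 0 < y / a := by positivity
    simp only [hx.not_gt, hy, h1.not_gt, h2, hy.not_ge, h2.not_ge, hx, h1,
      and_false, false_and, and_self, if_true, if_false, Real.sqrt_sq ha.le]
    rw [show -(y / a - x / b) ^ 2 / (2 * t)
      = -(y * b - x * a) ^ 2 / (2 * a ^ 2 * b ^ 2 * t) by field_simp]
    field_simp
  · have h2 : y / b ≤ 0 := div_nonpos_of_nonpos_of_nonneg hy hb.le
    rcases hx.lt_or_eq with hx | rfl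
    · have h1 : x / b < 0 := div_neg_of_neg_of_pos hx hb
      simp only [hx.not_gt, hy, h1.not_gt, h2, hy.not_gt, hx, h1,
        and_false, false_and, and_self, if_true, if_false, Real.sqrt_sq hb.le]
      rw [show -(y / b - x / b) ^ 2 / (2 * t) = -(y - x) ^ 2 / (2 * b ^ 2 * t) by field_simp,
        show -(y / b + x / b) ^ 2 / (2 * t) = -(y + x) ^ 2 / (2 * b ^ 2 * t) by field_simp]
      field_simp
      ring
    · simp only [lt_irrefl, zero_div, hy.not_gt, h2.not_gt, and_false, false_and, if_false,
        Real.sqrt_sq hb.le]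
      rw [show -(y / b - 0) ^ 2 / (2 * t)
        = -(y * a - 0 * b) ^ 2 / (2 * a ^ 2 * b ^ 2 * t) by field_simp; simp; ring]
      field_simp
      ring
end

section
/- (Interface-skewed exit probability.) Let ε > 0 and suppose u : [−ε,ε] → ℝ is continuous on [−ε,ε], twice continuously differentiable on (−ε,0) and on (0,ε) with u''(x) = 0 for all x ∈ (−ε,0) ∪ (0,ε), the one-sided derivative limits u'(0⁺) := lim_{x↓0} u'(x) and u'(0⁻) := lim_{x↑0} u'(x) exist and satisfy the conservative interface (flux-continuity) condition D⁺·u'(0⁺) = D⁻·u'(0⁻), and u(−ε) = 1, u(ε) = 0. Then u(0) = D⁻/(D⁺+D⁻). (In particular, the physical skew diffusion started at the interface exits the symmetric interval (−ε,ε) through −ε with probability D⁻/(D⁺+D⁻), i.e., it is skewed toward the side with the larger diffusion coefficient.) -/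
open MeasureTheory Real Filter Topology

/-- A function with vanishing second derivative on `(a, b)` has slope equal to any limit of its
derivative along a filter containing `(a, b)`. -/
lemma slope_eq_of_deriv_deriv_zero (u : ℝ → ℝ) (a b g : ℝ) (hab : a < b)
    (hc : ContinuousOn u (Set.Icc a b))
    (hd : ∀ x ∈ Set.Ioo a b, DifferentiableAt ℝ u x)
    (hd' : ∀ x ∈ Set.Ioo a b, DifferentiableAt ℝ (deriv u) x)
    (hdd : ∀ x ∈ Set.Ioo a b, deriv (deriv u) x = 0)
    (l : Filter ℝ) [l.NeBot] (hl : Set.Ioo a b ∈ l)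
    (hg : Filter.Tendsto (deriv u) l (nhds g)) : u b - u a = g * (b - a) := by
  obtain ⟨ξ, hξ, h⟩ := exists_deriv_eq_slope u hab hc
    (fun x hx => (hd x hx).differentiableWithinAt)
  have hconst : ∀ x ∈ Set.Ioo a b, deriv u x = deriv u ξ := fun x hx =>
    isOpen_Ioo.is_const_of_deriv_eq_zero isPreconnected_Ioo
      (fun y hy => (hd' y hy).differentiableWithinAt) (fun y hy => hdd y hy) hx hξ
  have h2 : Filter.Tendsto (deriv u) l (nhds (deriv u ξ)) := by
    refine tendsto_const_nhds.congr' ?_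
    filter_upwards [hl] with x hx using (hconst x hx).symm
  rw [tendsto_nhds_unique hg h2, h]
  have : b - a ≠ 0 := by linarith
  field_simp

/-- interface-skewed exit probability: any continuous function
on `[−ε, ε]` that is piecewise linear (second derivative zero) away from the
interface, satisfies the conservative flux-continuity condition
`D⁺·u'(0⁺) = D⁻·u'(0⁻)` at the interface, and has boundary values
`u(−ε) = 1`, `u(ε) = 0`, takes the value `D⁻/(D⁺ + D⁻)` at the interface. -/
theorem interface_exit_probability (Dp Dm : ℝ) (hDp : 0 < Dp) (hDm : 0 < Dm)
    (ε : ℝ) (hε : 0 < ε) (u : ℝ → ℝ)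
    (hcont : ContinuousOn u (Set.Icc (-ε) ε))
    (hdiff : ∀ x ∈ Set.Ioo (-ε) 0 ∪ Set.Ioo 0 ε, DifferentiableAt ℝ u x)
    (hdiff' : ∀ x ∈ Set.Ioo (-ε) 0 ∪ Set.Ioo 0 ε, DifferentiableAt ℝ (deriv u) x)
    (hdd : ∀ x ∈ Set.Ioo (-ε) 0 ∪ Set.Ioo 0 ε, deriv (deriv u) x = 0)
    (gp gm : ℝ)
    (hgp : Filter.Tendsto (deriv u) (nhdsWithin 0 (Set.Ioi 0)) (nhds gp))
    (hgm : Filter.Tendsto (deriv u) (nhdsWithin 0 (Set.Iio 0)) (nhds gm))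
    (hflux : Dp * gp = Dm * gm)
    (hleft : u (-ε) = 1) (hright : u ε = 0) :
    u 0 = Dm / (Dp + Dm) := by
  have h1 := slope_eq_of_deriv_deriv_zero u (-ε) 0 gm (by linarith)
    (hcont.mono (Set.Icc_subset_Icc le_rfl hε.le)) (fun x hx => hdiff x (Or.inl hx))
    (fun x hx => hdiff' x (Or.inl hx)) (fun x hx => hdd x (Or.inl hx))
    (nhdsWithin 0 (Set.Iio 0)) (Ioo_mem_nhdsLT (by linarith)) hgm
  have h2 := slope_eq_of_deriv_deriv_zero u 0 ε gp hε
    (hcont.mono (Set.Icc_subset_Icc (by linarith) le_rfl)) (fun x hx => hdiff x (Or.inr hx))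
    (fun x hx => hdiff' x (Or.inr hx)) (fun x hx => hdd x (Or.inr hx))
    (nhdsWithin 0 (Set.Ioi 0)) (Ioo_mem_nhdsGT hε) hgp
  rw [hleft] at h1
  rw [hright] at h2
  rw [eq_div_iff (by positivity)]
  linear_combination Dm * h1 - Dp * h2 - ε * hflux
end

section
/- (Interface-skewed expected exit time.) Let ε > 0 and suppose v : [−ε,ε] → ℝ is continuous on [−ε,ε], twice continuously differentiable on (−ε,0) and on (0,ε) with (1/2)·D⁺·v''(x) = −1 for all x ∈ (0,ε) and (1/2)·D⁻·v''(x) = −1 for all x ∈ (−ε,0), the one-sided derivative limits v'(0⁺) := lim_{x↓0} v'(x) and v'(0⁻) := lim_{x↑0} v'(x) exist and satisfy the conservative interface (flux-continuity) condition D⁺·v'(0⁺) = D⁻·v'(0⁻), and v(−ε) = v(ε) = 0. Then v(0) = 2ε²/(D⁺+D⁻). (In particular, the expected exit time of the physical skew diffusion started at the interface from the interval (−ε,ε) equals 2ε²/(D⁺+D⁻).) -/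
open MeasureTheory Real Filter Topology

theorem interface_aux (a b c g : ℝ) (hab : a < b) (v : ℝ → ℝ) (l : Filter ℝ) [l.NeBot]
    (hl : Set.Ioo a b ∈ l) (hl0 : l ≤ 𝓝 0)
    (hcont : ContinuousOn v (Set.Icc a b))
    (hdiff : ∀ x ∈ Set.Ioo a b, DifferentiableAt ℝ v x)
    (hdiff' : ∀ x ∈ Set.Ioo a b, DifferentiableAt ℝ (deriv v) x)
    (hdd : ∀ x ∈ Set.Ioo a b, deriv (deriv v) x = c)
    (hg : Tendsto (deriv v) l (𝓝 g)) :
    v b - v a = g * (b - a) + c * (b ^ 2 - a ^ 2) / 2 := by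
  have hu : ∀ x ∈ Set.Ioo a b, HasDerivAt (fun y => deriv v y - c * y) 0 x := by
    intro x hx
    have h1 := (hdiff' x hx).hasDerivAt
    rw [hdd x hx] at h1
    exact (h1.sub ((hasDerivAt_id x).const_mul c)).congr_deriv (by ring)
  have hconst : ∀ x ∈ Set.Ioo a b, deriv v x = g + c * x := by
    intro x hx
    have h2 : ∀ y ∈ Set.Ioo a b, deriv v y - c * y = deriv v x - c * x := fun y hy =>
      isOpen_Ioo.is_const_of_deriv_eq_zero isPreconnected_Ioo
        (fun z hz => (hu z hz).differentiableAt.differentiableWithinAt)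
        (fun z hz => (hu z hz).deriv) hy hx
    have h3 : Tendsto (fun y => deriv v y - c * y) l (𝓝 (g - c * 0)) :=
      hg.sub ((tendsto_id.mono_left hl0 : Tendsto (fun y : ℝ => y) l (𝓝 0)).const_mul c)
    have h4 : Tendsto (fun y => deriv v y - c * y) l (𝓝 (deriv v x - c * x)) :=
      tendsto_const_nhds.congr' (by filter_upwards [hl] with y hy using (h2 y hy).symm)
    have h5 := tendsto_nhds_unique h3 h4
    linarith
  have hw : ∀ x ∈ Set.Ioo a b,
      HasDerivAt (fun y => v y - (g * y + c / 2 * y ^ 2)) 0 x := by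
    intro x hx
    have h1 := (hdiff x hx).hasDerivAt
    rw [hconst x hx] at h1
    have h2 := h1.sub (((hasDerivAt_id x).const_mul g).add
      ((hasDerivAt_pow 2 x).const_mul (c / 2)))
    refine h2.congr_deriv ?_
    push_cast
    ring
  obtain ⟨x, hx, hs⟩ := exists_hasDerivAt_eq_slope
    (fun y => v y - (g * y + c / 2 * y ^ 2)) (fun _ => 0) hab
    (hcont.sub (by fun_prop)) hw
  have hne : b - a ≠ 0 := (sub_pos.2 hab).ne'
  rw [eq_div_iff hne] at hs
  linarith

/-- interface-skewed expected exit time: any continuous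
function on `[−ε, ε]` satisfying `(1/2)·D⁺·v'' = −1` on `(0, ε)` and
`(1/2)·D⁻·v'' = −1` on `(−ε, 0)`, the conservative flux-continuity condition
`D⁺·v'(0⁺) = D⁻·v'(0⁻)` at the interface, and vanishing at `±ε`, takes the
value `2ε²/(D⁺ + D⁻)` at the interface. -/
theorem interface_expected_exit_time (Dp Dm : ℝ) (hDp : 0 < Dp) (hDm : 0 < Dm)
    (ε : ℝ) (hε : 0 < ε) (v : ℝ → ℝ)
    (hcont : ContinuousOn v (Set.Icc (-ε) ε))
    (hdiff : ∀ x ∈ Set.Ioo (-ε) 0 ∪ Set.Ioo 0 ε, DifferentiableAt ℝ v x)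
    (hdiff' : ∀ x ∈ Set.Ioo (-ε) 0 ∪ Set.Ioo 0 ε, DifferentiableAt ℝ (deriv v) x)
    (hddp : ∀ x ∈ Set.Ioo 0 ε, (1 / 2) * Dp * deriv (deriv v) x = -1)
    (hddm : ∀ x ∈ Set.Ioo (-ε) 0, (1 / 2) * Dm * deriv (deriv v) x = -1)
    (gp gm : ℝ)
    (hgp : Filter.Tendsto (deriv v) (nhdsWithin 0 (Set.Ioi 0)) (nhds gp))
    (hgm : Filter.Tendsto (deriv v) (nhdsWithin 0 (Set.Iio 0)) (nhds gm))
    (hflux : Dp * gp = Dm * gm)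
    (hleft : v (-ε) = 0) (hright : v ε = 0) :
    v 0 = 2 * ε ^ 2 / (Dp + Dm) := by
  have hp := interface_aux 0 ε (-2 / Dp) gp hε v (𝓝[>] 0)
    (Ioo_mem_nhdsGT hε) nhdsWithin_le_nhds
    (hcont.mono (Set.Icc_subset_Icc (by linarith) le_rfl))
    (fun x hx => hdiff x (Or.inr hx)) (fun x hx => hdiff' x (Or.inr hx))
    (fun x hx => by rw [eq_div_iff hDp.ne']; linarith [hddp x hx]) hgp
  have hm := interface_aux (-ε) 0 (-2 / Dm) gm (by linarith) v (𝓝[<] 0)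
    (Ioo_mem_nhdsLT (by linarith)) nhdsWithin_le_nhds
    (hcont.mono (Set.Icc_subset_Icc le_rfl (by linarith)))
    (fun x hx => hdiff x (Or.inl hx)) (fun x hx => hdiff' x (Or.inl hx))
    (fun x hx => by rw [eq_div_iff hDm.ne']; linarith [hddm x hx]) hgm
  rw [hright] at hp
  rw [hleft] at hm
  have hp' : Dp * v 0 = ε ^ 2 - Dp * gp * ε := by
    have : v 0 = ε ^ 2 / Dp - gp * ε := by linear_combination -hp
    rw [this]; field_simp
  have hm' : Dm * v 0 = ε ^ 2 + Dm * gm * ε := by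
    have : v 0 = ε ^ 2 / Dm + gm * ε := by linear_combination hm
    rw [this]; field_simp
  rw [eq_div_iff (by positivity)]
  linear_combination hp' + hm' - ε * hflux
end

section
/- (Generalized Taylor–Aris dispersion across a single interface.) Let R > 0, v₀ ∈ ℝ and D⁺, D⁻ > 0. Define the parabolic velocity profile v₁(x) := v₀·(1 − x²/R²) for x ∈ [−R,R], its cross-sectional average v̄ := (1/(2R))·∫_{−R}^{R} v₁(x) dx, and g(y) := ∫_{−R}^{y} (v₁(x) − v̄) dx for y ∈ [−R,R]. Then the homogenized Taylor–Aris dispersion coefficient D̄ := (D⁺+D⁻)/2 + (1/(2R))·[(1/D⁻)·∫_{−R}^{0} g(y)² dy + (1/D⁺)·∫_{0}^{R} g(y)² dy] satisfies D̄ = D_a + (4·v₀²·R²)/(945·D_h), where D_a := (D⁺+D⁻)/2 is the arithmetic mean and D_h := 1/(1/D⁺ + 1/D⁻). -/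
open MeasureTheory Real Filter Topology intervalIntegral

/-- Integral of an even quadratic. -/
lemma integral_quad_aux (a b c d : ℝ) :
    ∫ x in a..b, (c + d * x ^ 2) = (c * b + d * b ^ 3 / 3) - (c * a + d * a ^ 3 / 3) := by
  rw [intervalIntegral.integral_add (by simp) (Continuous.intervalIntegrable (by fun_prop) _ _),
    intervalIntegral.integral_const_mul, integral_pow, intervalIntegral.integral_const]
  simp only [smul_eq_mul]
  norm_num
  ring

/-- Integral of an even sextic without constant term. -/
lemma integral_sextic_aux (a b c d e : ℝ) :
    ∫ x in a..b, (c * x ^ 2 + d * x ^ 4 + e * x ^ 6) =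
      c * (b ^ 3 - a ^ 3) / 3 + d * (b ^ 5 - a ^ 5) / 5 + e * (b ^ 7 - a ^ 7) / 7 := by
  rw [intervalIntegral.integral_add (Continuous.intervalIntegrable (by fun_prop) _ _)
      (Continuous.intervalIntegrable (by fun_prop) _ _),
    intervalIntegral.integral_add (Continuous.intervalIntegrable (by fun_prop) _ _)
      (Continuous.intervalIntegrable (by fun_prop) _ _),
    intervalIntegral.integral_const_mul, intervalIntegral.integral_const_mul,
    intervalIntegral.integral_const_mul, integral_pow, integral_pow, integral_pow]
  norm_num
  ring

/-- generalized Taylor–Aris dispersion across a single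
interface: for the parabolic velocity profile `v₁(x) = v₀(1 − x²/R²)` on a
channel `[−R, R]` with diffusion coefficient `D⁻` on `[−R, 0]` and `D⁺` on
`[0, R]`, the homogenized dispersion coefficient equals
`(D⁺+D⁻)/2 + 4 v₀² R² / (945 D_h)` with `D_h` the harmonic mean. -/
theorem generalized_taylor_aris (R v₀ Dp Dm : ℝ)
    (hR : 0 < R) (hDp : 0 < Dp) (hDm : 0 < Dm) :
    let v₁ : ℝ → ℝ := fun x => v₀ * (1 - x ^ 2 / R ^ 2)
    let vbar : ℝ := (1 / (2 * R)) * ∫ x in (-R)..R, v₁ x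
    let g : ℝ → ℝ := fun y => ∫ x in (-R)..y, (v₁ x - vbar)
    (Dp + Dm) / 2 +
        (1 / (2 * R)) * ((1 / Dm) * (∫ y in (-R)..(0 : ℝ), (g y) ^ 2) +
          (1 / Dp) * (∫ y in (0 : ℝ)..R, (g y) ^ 2)) =
      (Dp + Dm) / 2 + 4 * v₀ ^ 2 * R ^ 2 / (945 * (1 / (1 / Dp + 1 / Dm))) := by
  intro v₁ vbar g
  have hR0 : R ≠ 0 := hR.ne'
  have hv : vbar = 2 * v₀ / 3 := by
    have h1 : v₁ = fun x => v₀ + (-(v₀ / R ^ 2)) * x ^ 2 := by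
      funext x
      simp only [v₁]
      ring
    simp only [vbar]
    rw [h1, integral_quad_aux]
    field_simp
    ring
  have hg : ∀ y, g y = v₀ / 3 * (y - y ^ 3 / R ^ 2) := by
    intro y
    have h1 : (fun x => v₁ x - vbar) = fun x => v₀ / 3 + (-(v₀ / R ^ 2)) * x ^ 2 := by
      funext x
      rw [hv]
      simp only [v₁]
      ring
    simp only [g]
    rw [h1, integral_quad_aux]
    field_simp
    ring
  have hg2 : (fun y => (g y) ^ 2) = fun y => (v₀ ^ 2 / 9) * y ^ 2 +
      (-(2 * v₀ ^ 2 / (9 * R ^ 2))) * y ^ 4 + (v₀ ^ 2 / (9 * R ^ 4)) * y ^ 6 := by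
    funext y
    rw [hg]
    field_simp
    ring
  rw [hg2, integral_sextic_aux, integral_sextic_aux]
  have hs : 1 / Dp + 1 / Dm ≠ 0 := by positivity
  field_simp
  ring
end

section
/- (Natural occupation time comparison for skew diffusion.) Fix 0 < λ < 1 and define the expected natural occupation times of the positive and negative half-lines for the λ-interface skew diffusion started at the interface: Γ⁺_λ(t) := ∫_0^t (∫_{(0,∞)} q_λ(s,0,y) dy) ds and Γ⁻_λ(t) := ∫_0^t (∫_{(−∞,0)} q_λ(s,0,y) dy) ds. Then for every t > 0: Γ⁺_λ(t) > Γ⁻_λ(t) if and only if λ > √D⁺/(√D⁺+√D⁻); and Γ⁺_λ(t) = Γ⁻_λ(t) if λ = √D⁺/(√D⁺+√D⁻). -/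
open MeasureTheory Real Filter Topology

/-- The transmission parameter associated with the interface parameter `λ`:
`α(λ) = λ√D⁻ / (λ√D⁻ + (1−λ)√D⁺)`. -/
noncomputable def alphaOf (Dp Dm lam : ℝ) : ℝ :=
  lam * Real.sqrt Dm / (lam * Real.sqrt Dm + (1 - lam) * Real.sqrt Dp)

/-- The transition density of the `λ`-interface skew diffusion. -/
noncomputable def qLam (Dp Dm lam t x y : ℝ) : ℝ :=
  pSkew (alphaOf Dp Dm lam) t (sInv Dp Dm x) (sInv Dp Dm y) /
    Real.sqrt (Dcoef Dp Dm y)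

lemma half_gauss (D s : ℝ) (hD : 0 < D) (hs : 0 < s) :
    ∫ y in Set.Ioi (0 : ℝ), gaussKernel s (y / √D) / √D = 1 / 2 := by
  have h : ∀ y : ℝ, gaussKernel s (y / √D) / √D
      = ((√(2 * π * s))⁻¹ / √D) * Real.exp (-(1 / (2 * s * D)) * y ^ 2) := by
    intro y
    have : -(y / √D) ^ 2 / (2 * s) = -(1 / (2 * s * D)) * y ^ 2 := by
      rw [div_pow, Real.sq_sqrt hD.le]
      field_simp
    rw [gaussKernel, this]
    ring
  simp_rw [h]
  rw [integral_const_mul, integral_gaussian_Ioi]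
  have e : π / (1 / (2 * s * D)) = (2 * π * s) * D := by field_simp
  have hp : 0 < 2 * π * s := by positivity
  rw [e, Real.sqrt_mul hp.le]
  have := Real.sqrt_pos.2 hp
  have := Real.sqrt_pos.2 hD
  field_simp

lemma qLam_pos_int (Dp Dm lam s : ℝ) (hDp : 0 < Dp) (hs : 0 < s) :
    ∫ y in Set.Ioi (0 : ℝ), qLam Dp Dm lam s 0 y = alphaOf Dp Dm lam := by
  have h : ∀ y ∈ Set.Ioi (0 : ℝ), qLam Dp Dm lam s 0 y
      = (2 * alphaOf Dp Dm lam) * (gaussKernel s (y / √Dp) / √Dp) := by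
    intro y hy
    have hy' : 0 < y := hy
    have h1 : 0 < y / √Dp := div_pos hy' (Real.sqrt_pos.2 hDp)
    simp [qLam, pSkew, sInv, Dcoef, hy', h1]
    ring
  rw [setIntegral_congr_fun measurableSet_Ioi h, integral_const_mul, half_gauss Dp s hDp hs]
  ring

lemma qLam_neg_int (Dp Dm lam s : ℝ) (hDm : 0 < Dm) (hs : 0 < s) :
    ∫ y in Set.Iio (0 : ℝ), qLam Dp Dm lam s 0 y = 1 - alphaOf Dp Dm lam := by
  have h : ∀ y ∈ Set.Ioi (0 : ℝ), qLam Dp Dm lam s 0 (-y)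
      = (2 * (1 - alphaOf Dp Dm lam)) * (gaussKernel s (y / √Dm) / √Dm) := by
    intro y hy
    have hy' : 0 < y := hy
    have h0 : ¬ (y < 0) := not_lt.2 hy'.le
    have h1 : 0 < y / √Dm := div_pos hy' (Real.sqrt_pos.2 hDm)
    have h2 : ¬ (y / √Dm < 0) := not_lt.2 h1.le
    simp [qLam, pSkew, sInv, Dcoef, h0, h2, gaussKernel, neg_div]
    ring
  have e := integral_comp_neg_Ioi (0 : ℝ) (fun y => qLam Dp Dm lam s 0 y)
  rw [neg_zero, integral_Iic_eq_integral_Iio] at e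
  rw [← e, setIntegral_congr_fun measurableSet_Ioi h, integral_const_mul, half_gauss Dm s hDm hs]
  ring

/-- comparison of expected natural occupation times of the two
half-lines for the `λ`-interface skew diffusion started at the interface. -/
theorem qLam_occupation_time_comparison (Dp Dm : ℝ) (hDp : 0 < Dp) (hDm : 0 < Dm)
    (lam : ℝ) (hlam₀ : 0 < lam) (hlam₁ : lam < 1) (t : ℝ) (ht : 0 < t) :
    ((∫ s in (0 : ℝ)..t, ∫ y in Set.Ioi (0 : ℝ), qLam Dp Dm lam s 0 y) >
        (∫ s in (0 : ℝ)..t, ∫ y in Set.Iio (0 : ℝ), qLam Dp Dm lam s 0 y) ↔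
      lam > Real.sqrt Dp / (Real.sqrt Dp + Real.sqrt Dm)) ∧
    (lam = Real.sqrt Dp / (Real.sqrt Dp + Real.sqrt Dm) →
      (∫ s in (0 : ℝ)..t, ∫ y in Set.Ioi (0 : ℝ), qLam Dp Dm lam s 0 y) =
        (∫ s in (0 : ℝ)..t, ∫ y in Set.Iio (0 : ℝ), qLam Dp Dm lam s 0 y)) := by
  have hP : (∫ s in (0 : ℝ)..t, ∫ y in Set.Ioi (0 : ℝ), qLam Dp Dm lam s 0 y)
      = t * alphaOf Dp Dm lam := by
    rw [intervalIntegral.integral_of_le ht.le, setIntegral_congr_fun measurableSet_Ioc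
      (fun s hs => qLam_pos_int Dp Dm lam s hDp hs.1)]
    simp [ht.le]
  have hM : (∫ s in (0 : ℝ)..t, ∫ y in Set.Iio (0 : ℝ), qLam Dp Dm lam s 0 y)
      = t * (1 - alphaOf Dp Dm lam) := by
    rw [intervalIntegral.integral_of_le ht.le, setIntegral_congr_fun measurableSet_Ioc
      (fun s hs => qLam_neg_int Dp Dm lam s hDm hs.1)]
    simp [ht.le]
  rw [hP, hM]
  have a := Real.sqrt_pos.2 hDp
  have b := Real.sqrt_pos.2 hDm
  have hd : 0 < lam * √Dm + (1 - lam) * √Dp :=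
    add_pos (mul_pos hlam₀ b) (mul_pos (by linarith) a)
  have e : 1 - alphaOf Dp Dm lam
      = (1 - lam) * √Dp / (lam * √Dm + (1 - lam) * √Dp) := by
    rw [alphaOf]; field_simp; ring
  rw [e, alphaOf]
  constructor
  · rw [gt_iff_lt, gt_iff_lt, mul_lt_mul_iff_right₀ ht, div_lt_div_iff_of_pos_right hd,
      div_lt_iff₀ (by positivity)]
    constructor <;> intro h <;> linarith
  · intro h
    rw [eq_div_iff (by positivity)] at h
    have : lam * √Dm = (1 - lam) * √Dp := by linarith
    rw [this]
end

section
/- (Fixed-time central limit theorem for the skew random walk.) Let (Y_n)_{n≥0} be an α-skew random walk started at Y₀ = 0. Then the law of Y_n/√n converges weakly, as n → ∞, to the Borel probability measure on ℝ with Lebesgue density f(y) = 2α·(2π)^{-1/2}·exp(−y²/2) for y > 0 and f(y) = 2(1−α)·(2π)^{-1/2}·exp(−y²/2) for y ≤ 0. -/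
open MeasureTheory Real Filter Topology

/-- One-step transition probabilities of the `α`-skew random walk on `ℤ`:
from `i ≠ 0` it moves to `i ± 1` with probability `1/2` each; from `0` it
moves to `1` with probability `α` and to `−1` with probability `1 − α`. -/
noncomputable def skewStep (α : ℝ) (i j : ℤ) : ℝ :=
  if i = 0 then (if j = 1 then α else if j = -1 then 1 - α else 0)
  else (if j = i + 1 ∨ j = i - 1 then 1 / 2 else 0)

/-- The density of the limiting distribution: `2α·φ(y)` for `y > 0` and
`2(1−α)·φ(y)` for `y ≤ 0`, with `φ` the standard Gaussian density. -/
noncomputable def skewLimitDensity (α y : ℝ) : ℝ :=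
  if 0 < y then 2 * α * (Real.sqrt (2 * Real.pi))⁻¹ * Real.exp (-y ^ 2 / 2)
  else 2 * (1 - α) * (Real.sqrt (2 * Real.pi))⁻¹ * Real.exp (-y ^ 2 / 2)

open ProbabilityTheory

/-- Transition operator. -/
noncomputable def skewOp (α : ℝ) (f : ℤ → ℝ) (i : ℤ) : ℝ :=
  if i = 0 then α * f 1 + (1 - α) * f (-1) else (f (i + 1) + f (i - 1)) / 2

/-- Folding operator. -/
noncomputable def skewFold (α : ℝ) (f : ℤ → ℝ) (i : ℤ) : ℝ :=
  α * f |i| + (1 - α) * f (-|i|)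

lemma skewOp_fold (α : ℝ) (f : ℤ → ℝ) : skewOp α (skewFold α f) = skewFold α (skewOp α f) := by
  funext i
  rcases lt_trichotomy i 0 with h | h | h
  · have h1 : |i| = -i := abs_of_neg h
    have h2 : |i + 1| = -(i+1) := abs_of_nonpos (by omega)
    have h3 : |i - 1| = -(i-1) := abs_of_neg (by omega)
    have h4 : -i ≠ 0 := by omega
    have h5 : i ≠ 0 := by omega
    simp only [skewOp, skewFold, h1, h2, h3, h4, h5, if_false, neg_neg]
    have e1 : -(i+1) = -i - 1 := by ring
    have e2 : -(i-1) = -i + 1 := by ring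
    rw [e1, e2]; ring
  · subst h
    simp [skewOp, skewFold]
  · have h1 : |i| = i := abs_of_pos h
    have h2 : |i + 1| = (i+1) := abs_of_pos (by omega)
    have h3 : |i - 1| = (i-1) := abs_of_nonneg (by omega)
    have h4 : -i ≠ 0 := by omega
    have h5 : i ≠ 0 := by omega
    simp only [skewOp, skewFold, h1, h2, h3, h4, h5, if_false]
    have e1 : -(i+1) = -i - 1 := by ring
    have e2 : -(i-1) = -i + 1 := by ring
    rw [e1, e2]; ring

lemma skewOp_cos (α t : ℝ) (i : ℤ) :
    skewOp α (fun i => Real.cos (t * i)) i = Real.cos t * Real.cos (t * i) := by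
  unfold skewOp
  split_ifs with h
  · subst h; simp; ring
  · push_cast
    rw [mul_add, mul_sub, Real.cos_add, Real.cos_sub]; simp; ring

lemma tsum_skewStep (α : ℝ) (f : ℤ → ℝ) (i : ℤ) :
    ∑' j, skewStep α i j * f j = skewOp α f i := by
  rw [tsum_eq_sum (s := {i + 1, i - 1})]
  · rw [Finset.sum_pair (by omega)]
    unfold skewStep skewOp
    split_ifs <;> simp_all <;> ring
  · intro j hj
    simp only [Finset.mem_insert, Finset.mem_singleton, not_or] at hj
    unfold skewStep
    split_ifs with h1 h2 h3 h4 <;> simp_all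

lemma skewStep_nonneg (α : ℝ) (h0 : 0 < α) (h1 : α < 1) (i j : ℤ) : 0 ≤ skewStep α i j := by
  unfold skewStep
  split_ifs <;> linarith

section
variable {Ω : Type*} [MeasurableSpace Ω] {μ : Measure Ω} [IsProbabilityMeasure μ] {α : ℝ}
  {Y : ℕ → Ω → ℤ}

lemma skew_joint (hα₀ : 0 < α) (hα₁ : α < 1) (hmeas : ∀ n, Measurable (Y n))
    (hMarkov : ∀ (n : ℕ) (path : ℕ → ℤ) (j : ℤ),
      (μ ({ω | ∀ k ≤ n, Y k ω = path k} ∩ {ω | Y (n + 1) ω = j})).toReal =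
        skewStep α (path n) j * (μ {ω | ∀ k ≤ n, Y k ω = path k}).toReal)
    (n : ℕ) (i j : ℤ) :
    μ.real ({ω | Y n ω = i} ∩ {ω | Y (n + 1) ω = j}) = skewStep α i j * μ.real {ω | Y n ω = i} := by
  let X : Ω → (Fin (n+1) → ℤ) := fun ω k => Y k ω
  have hX : Measurable X := measurable_pi_lambda _ fun k => hmeas k
  have hjm : MeasurableSet {ω | Y (n + 1) ω = j} := hmeas (n+1) (measurableSet_singleton j)
  have key : (μ.restrict {ω | Y (n + 1) ω = j}).map X
      = (μ.map X).withDensity (fun v => ENNReal.ofReal (skewStep α (v (Fin.last n)) j)) := by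
    refine Measure.ext_of_singleton fun v => ?_
    have hv : MeasurableSet ({v} : Set (Fin (n+1) → ℤ)) := measurableSet_singleton v
    let path : ℕ → ℤ := fun k => if h : k < n + 1 then v ⟨k, h⟩ else 0
    have hs : X ⁻¹' {v} = {ω | ∀ k ≤ n, Y k ω = path k} := by
      ext ω
      simp only [Set.mem_preimage, Set.mem_singleton_iff, Set.mem_ofPred_eq, X, path]
      constructor
      · rintro rfl k hk
        simp [Nat.lt_succ_of_le hk]
      · intro h
        funext k
        have := h k (by omega)
        simpa [Nat.le_of_lt_succ k.2] using this
    have hp : path n = v (Fin.last n) := by simp [path, Fin.last]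
    rw [Measure.map_apply hX hv, Measure.restrict_apply (hX hv), withDensity_apply _ hv,
      Measure.restrict_singleton, lintegral_smul_measure, lintegral_dirac,
      Measure.map_apply hX hv, hs, ← hp, smul_eq_mul, mul_comm]
    rw [← ENNReal.ofReal_toReal (measure_ne_top μ
      ({ω | ∀ k ≤ n, Y k ω = path k} ∩ {ω | Y (n + 1) ω = j})), hMarkov,
      ENNReal.ofReal_mul (skewStep_nonneg α hα₀ hα₁ _ _), ENNReal.ofReal_toReal (measure_ne_top _ _)]
  have hS : MeasurableSet {v : Fin (n+1) → ℤ | v (Fin.last n) = i} := Set.to_countable _ |>.measurableSet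
  have h2 := congrArg (fun m => m {v : Fin (n+1) → ℤ | v (Fin.last n) = i}) key
  have hpre : X ⁻¹' {v : Fin (n+1) → ℤ | v (Fin.last n) = i} = {ω | Y n ω = i} := by
    ext ω; simp [X]
  rw [Measure.map_apply hX hS, Measure.restrict_apply (hX hS), withDensity_apply _ hS,
    setLIntegral_congr_fun (g := fun _ => ENNReal.ofReal (skewStep α i j)) hS
      (fun v hv => by simp only [Set.mem_ofPred_eq] at hv; simp [hv]),
    setLIntegral_const, Measure.map_apply hX hS, hpre] at h2
  rw [measureReal_def, h2, ENNReal.toReal_mul,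
    ENNReal.toReal_ofReal (skewStep_nonneg α hα₀ hα₁ _ _), measureReal_def]

lemma skew_integrable_s18 (Z : Ω → ℤ) (hZ : Measurable Z) (f : ℤ → ℝ) (C : ℝ)
    (hf : ∀ i, |f i| ≤ C) : Integrable (fun ω => f (Z ω)) μ :=
  Integrable.of_bound ((measurable_of_countable f).comp hZ).aestronglyMeasurable C
    (ae_of_all _ fun _ => hf _)

lemma skew_step (hα₀ : 0 < α) (hα₁ : α < 1) (hmeas : ∀ n, Measurable (Y n))
    (hMarkov : ∀ (n : ℕ) (path : ℕ → ℤ) (j : ℤ),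
      (μ ({ω | ∀ k ≤ n, Y k ω = path k} ∩ {ω | Y (n + 1) ω = j})).toReal =
        skewStep α (path n) j * (μ {ω | ∀ k ≤ n, Y k ω = path k}).toReal)
    (n : ℕ) (f : ℤ → ℝ) (C : ℝ) (hf : ∀ i, |f i| ≤ C) :
    ∫ ω, f (Y (n + 1) ω) ∂μ = ∫ ω, skewOp α f (Y n ω) ∂μ := by
  have hC : 0 ≤ C := (abs_nonneg _).trans (hf 0)
  have hP : ∀ i, |skewOp α f i| ≤ C := by
    intro i
    unfold skewOp
    have a1 := fun i => (abs_le.1 (hf i)).1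
    have a2 := fun i => (abs_le.1 (hf i)).2
    split_ifs
    · rw [abs_le]; constructor <;> nlinarith [a1 1, a1 (-1), a2 1, a2 (-1)]
    · rw [abs_le]
      constructor <;> linarith [a1 (i+1), a1 (i-1), a2 (i+1), a2 (i-1)]
  have hpair : Measurable (fun ω => (Y n ω, Y (n+1) ω)) := (hmeas n).prodMk (hmeas (n+1))
  have hi1 : Integrable (fun p : ℤ × ℤ => f p.2) (μ.map (fun ω => (Y n ω, Y (n+1) ω))) := by
    have := Measure.isProbabilityMeasure_map (μ := μ) hpair.aemeasurable
    exact Integrable.of_bound (measurable_of_countable _).aestronglyMeasurable C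
      (ae_of_all _ fun p => hf _)
  have hi2 : Integrable (skewOp α f) (μ.map (Y n)) := by
    have := Measure.isProbabilityMeasure_map (μ := μ) (hmeas n).aemeasurable
    exact Integrable.of_bound (measurable_of_countable _).aestronglyMeasurable C
      (ae_of_all _ fun p => hP _)
  have e1 : ∫ ω, f (Y (n + 1) ω) ∂μ = ∫ p, f p.2 ∂(μ.map (fun ω => (Y n ω, Y (n+1) ω))) := by
    rw [integral_map hpair.aemeasurable hi1.aestronglyMeasurable]
  have e2 : ∫ ω, skewOp α f (Y n ω) ∂μ = ∫ i, skewOp α f i ∂(μ.map (Y n)) := by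
    rw [integral_map (hmeas n).aemeasurable hi2.aestronglyMeasurable]
  have hm : ∀ p : ℤ × ℤ, (μ.map (fun ω => (Y n ω, Y (n+1) ω))).real {p}
      = skewStep α p.1 p.2 * (μ.map (Y n)).real {p.1} := by
    rintro ⟨i, j⟩
    rw [map_measureReal_apply hpair (measurableSet_singleton _),
      map_measureReal_apply (hmeas n) (measurableSet_singleton _)]
    have := skew_joint hα₀ hα₁ hmeas hMarkov n i j
    have hset : (fun ω => (Y n ω, Y (n+1) ω)) ⁻¹' {(i, j)}
        = {ω | Y n ω = i} ∩ {ω | Y (n + 1) ω = j} := by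
      ext ω; simp
    rw [hset]
    exact this
  have hsum : Summable (fun p : ℤ × ℤ =>
      (μ.map (fun ω => (Y n ω, Y (n+1) ω))).real {p} • f p.2) := by
    have := Measure.isProbabilityMeasure_map (μ := μ) hpair.aemeasurable
    have h1 : Summable (fun p : ℤ × ℤ => (μ.map (fun ω => (Y n ω, Y (n+1) ω))).real {p}) := by
      refine ENNReal.summable_toReal ?_
      rw [← measure_iUnion (fun a b hab => by simpa using hab)
        (fun p => measurableSet_singleton p)]
      exact measure_ne_top _ _
    refine Summable.of_norm_bounded (h1.mul_right C) fun p => ?_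
    rw [smul_eq_mul, norm_mul, Real.norm_of_nonneg measureReal_nonneg]
    exact mul_le_mul_of_nonneg_left (hf _) measureReal_nonneg
  rw [e1, e2, integral_countable hi1, integral_countable hi2, hsum.tsum_prod]
  refine tsum_congr fun i => ?_
  rw [← tsum_skewStep, smul_eq_mul, ← tsum_mul_left]
  refine tsum_congr fun j => ?_
  rw [hm]; simp; ring

lemma skew_fold (hα₀ : 0 < α) (hα₁ : α < 1) (hmeas : ∀ n, Measurable (Y n))
    (hstart : ∀ ω, Y 0 ω = 0)
    (hMarkov : ∀ (n : ℕ) (path : ℕ → ℤ) (j : ℤ),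
      (μ ({ω | ∀ k ≤ n, Y k ω = path k} ∩ {ω | Y (n + 1) ω = j})).toReal =
        skewStep α (path n) j * (μ {ω | ∀ k ≤ n, Y k ω = path k}).toReal)
    (n : ℕ) : ∀ (f : ℤ → ℝ) (C : ℝ) (_ : ∀ i, |f i| ≤ C),
    ∫ ω, f (Y n ω) ∂μ = ∫ ω, skewFold α f (Y n ω) ∂μ := by
  induction n with
  | zero => intro f C hf; simp [hstart, skewFold]; ring
  | succ n ih =>
    intro f C hf
    have hP : ∀ i, |skewOp α f i| ≤ C := by
      intro i
      unfold skewOp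
      have a1 := fun i => (abs_le.1 (hf i)).1
      have a2 := fun i => (abs_le.1 (hf i)).2
      split_ifs
      · rw [abs_le]; constructor <;> nlinarith [a1 1, a1 (-1), a2 1, a2 (-1)]
      · rw [abs_le]
        constructor <;> linarith [a1 (i+1), a1 (i-1), a2 (i+1), a2 (i-1)]
    have hT : ∀ i, |skewFold α f i| ≤ C := by
      intro i
      unfold skewFold
      have a1 := fun i => (abs_le.1 (hf i)).1
      have a2 := fun i => (abs_le.1 (hf i)).2
      rw [abs_le]
      constructor <;> nlinarith [a1 |i|, a1 (-|i|), a2 |i|, a2 (-|i|)]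
    rw [skew_step hα₀ hα₁ hmeas hMarkov n f C hf, ih _ C hP,
      skew_step hα₀ hα₁ hmeas hMarkov n _ C hT, skewOp_fold]

lemma skew_cos (hα₀ : 0 < α) (hα₁ : α < 1) (hmeas : ∀ n, Measurable (Y n))
    (hstart : ∀ ω, Y 0 ω = 0)
    (hMarkov : ∀ (n : ℕ) (path : ℕ → ℤ) (j : ℤ),
      (μ ({ω | ∀ k ≤ n, Y k ω = path k} ∩ {ω | Y (n + 1) ω = j})).toReal =
        skewStep α (path n) j * (μ {ω | ∀ k ≤ n, Y k ω = path k}).toReal)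
    (n : ℕ) (t : ℝ) : ∫ ω, Real.cos (t * Y n ω) ∂μ = Real.cos t ^ n := by
  induction n with
  | zero => simp [hstart]
  | succ n ih =>
    rw [skew_step hα₀ hα₁ hmeas hMarkov n (fun i => Real.cos (t * i)) 1
      (fun i => Real.abs_cos_le_one _)]
    simp_rw [skewOp_cos]
    rw [integral_const_mul, ih]; ring

end

lemma tendsto_cos_pow (t : ℝ) :
    Tendsto (fun n : ℕ => Real.cos (t / √n) ^ n) atTop (𝓝 (Real.exp (-t ^ 2 / 2))) := by
  have h : Tendsto (fun n : ℕ => (n : ℝ) * (Real.cos (t / √n) - 1)) atTop (𝓝 (-t ^ 2 / 2)) := by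
    have h0 : Tendsto (fun n : ℕ => t / √n / 2) atTop (𝓝 0) := by
      have : Tendsto (fun n : ℕ => √(n : ℝ)) atTop atTop :=
        Real.tendsto_sqrt_atTop.comp tendsto_natCast_atTop_atTop
      simpa using (this.const_div_atTop t).div_const 2
    have h1 : Tendsto (fun n : ℕ => -t ^ 2 / 2 * sinc (t / √n / 2) ^ 2) atTop (𝓝 (-t ^ 2 / 2)) := by
      have := ((continuous_sinc.tendsto 0).comp h0).pow 2 |>.const_mul (-t ^ 2 / 2)
      simpa using this
    refine h1.congr' ?_
    filter_upwards [eventually_gt_atTop 0] with n hn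
    have hn' : (0:ℝ) < n := by exact_mod_cast hn
    have hs : ∀ x : ℝ, Real.sin x = x * sinc x := by
      intro x
      by_cases hx : x = 0
      · simp [hx]
      · rw [sinc_of_ne_zero hx]; field_simp
    have hc : Real.cos (t / √n) - 1 = - 2 * Real.sin (t / √n / 2) ^ 2 := by
      have := Real.cos_sq_add_sin_sq (t / √n / 2)
      have h2 := Real.cos_two_mul (t / √n / 2)
      rw [show 2 * (t / √n / 2) = t / √n by ring] at h2
      rw [h2]; linarith
    rw [hc, hs, mul_pow, div_pow, div_pow, Real.sq_sqrt hn'.le]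
    field_simp
  have := Real.tendsto_one_add_pow_exp_of_tendsto h
  simpa using this

lemma skew_limit_integral (α : ℝ) (f : BoundedContinuousFunction ℝ ℝ) :
    ∫ x, (α * f |x| + (1 - α) * f (-|x|)) ∂(gaussianReal 0 1)
      = ∫ y : ℝ, f y * skewLimitDensity α y := by
  rw [integral_gaussianReal_eq_integral_smul (by simp)]
  have hg : Integrable (gaussianPDFReal 0 1) := integrable_gaussianPDFReal 0 1
  have hpdf : ∀ x : ℝ, gaussianPDFReal 0 1 x = (√(2 * π))⁻¹ * Real.exp (-x ^ 2 / 2) := by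
    intro x; simp [gaussianPDFReal]
  have hpe : ∀ x : ℝ, gaussianPDFReal 0 1 |x| = gaussianPDFReal 0 1 x := by
    intro x; simp [hpdf]
  have hfb : ∀ g : ℝ → ℝ, Measurable g →
      Integrable (fun x => f (g x) * gaussianPDFReal 0 1 x) := by
    intro g hgm
    exact hg.bdd_mul (f.continuous.measurable.comp hgm).aestronglyMeasurable
      (ae_of_all _ fun x => f.norm_coe_le_norm _)
  have hL : ∫ x : ℝ, gaussianPDFReal 0 1 x • (α * f |x| + (1 - α) * f (-|x|))
      = 2 * ∫ x in Set.Ioi (0:ℝ), gaussianPDFReal 0 1 x • (α * f x + (1 - α) * f (-x)) := by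
    rw [← integral_comp_abs (f := fun x => gaussianPDFReal 0 1 x • (α * f x + (1 - α) * f (-x)))]
    simp_rw [hpe]
  have hden : Integrable (fun y => f y * skewLimitDensity α y) := by
    have : (fun y => f y * skewLimitDensity α y) = fun y => (if 0 < y then 2 * α else 2 * (1 - α)) *
        (f y * gaussianPDFReal 0 1 y) := by
      funext y
      rw [hpdf]; unfold skewLimitDensity
      split_ifs <;> ring
    rw [this]
    refine (hfb id measurable_id).bdd_mul (c := |2 * α| + |2 * (1 - α)|)
      (Measurable.ite measurableSet_Ioi measurable_const measurable_const).aestronglyMeasurable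
      (ae_of_all _ fun x => ?_)
    simp only [Real.norm_eq_abs]
    split_ifs <;> linarith [abs_nonneg (2 * α), abs_nonneg (2 * (1 - α))]
  rw [hL, ← integral_add_compl (measurableSet_Ioi (a := (0:ℝ))) hden, Set.compl_Ioi]
  have e1 : ∫ x in Set.Ioi (0:ℝ), f x * skewLimitDensity α x
      = ∫ x in Set.Ioi (0:ℝ), 2 * α * (f x * gaussianPDFReal 0 1 x) := by
    refine setIntegral_congr_fun measurableSet_Ioi fun x hx => ?_
    simp only [Set.mem_Ioi] at hx
    simp only [hpdf, skewLimitDensity, hx, if_true]; ring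
  have e2 : ∫ x in Set.Iic (0:ℝ), f x * skewLimitDensity α x
      = ∫ x in Set.Ioi (0:ℝ), 2 * (1 - α) * (f (-x) * gaussianPDFReal 0 1 x) := by
    rw [← neg_zero, ← integral_comp_neg_Ioi, neg_zero]
    refine setIntegral_congr_fun measurableSet_Ioi fun x hx => ?_
    simp only [Set.mem_Ioi] at hx
    have : ¬ (0 < -x) := by linarith
    simp only [hpdf, skewLimitDensity, this, if_false, neg_sq]; ring
  rw [e1, e2, ← integral_add, ← integral_const_mul]
  · refine integral_congr_ae (ae_of_all _ fun x => ?_)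
    simp only [smul_eq_mul]; ring
  · exact ((hfb id measurable_id).const_mul _).integrableOn
  · exact ((hfb (fun x => -x) measurable_neg).const_mul _).integrableOn

/-- fixed-time central limit theorem for the skew random walk:
if `(Y n)` is an `α`-skew random walk started at `0`, then the law of
`Y n / √n` converges weakly as `n → ∞` to the measure on `ℝ` with density
`skewLimitDensity α`, i.e. integrals of every bounded continuous function
converge. -/
theorem skew_random_walk_clt (α : ℝ) (hα₀ : 0 < α) (hα₁ : α < 1)
    (Ω : Type*) [MeasurableSpace Ω] (μ : Measure Ω) [IsProbabilityMeasure μ]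
    (Y : ℕ → Ω → ℤ) (hmeas : ∀ n, Measurable (Y n))
    (hstart : ∀ ω, Y 0 ω = 0)
    (hMarkov : ∀ (n : ℕ) (path : ℕ → ℤ) (j : ℤ),
      (μ ({ω | ∀ k ≤ n, Y k ω = path k} ∩ {ω | Y (n + 1) ω = j})).toReal =
        skewStep α (path n) j * (μ {ω | ∀ k ≤ n, Y k ω = path k}).toReal) :
    ∀ f : BoundedContinuousFunction ℝ ℝ,
      Filter.Tendsto
        (fun n : ℕ => ∫ ω, f ((Y n ω : ℝ) / Real.sqrt n) ∂μ)
        Filter.atTop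
        (nhds (∫ y : ℝ, f y * skewLimitDensity α y)) := by
  intro f
  let Z : ℕ → Ω → ℝ := fun n ω => (Y n ω : ℝ) / √n
  have hZ : ∀ n, Measurable (Z n) := fun n =>
    (measurable_of_countable (fun i : ℤ => (i : ℝ) / √n)).comp (hmeas n)
  let σ : ℕ → Measure ℝ := fun n =>
    (2⁻¹ : ENNReal) • (μ.map (Z n) + μ.map (fun ω => - Z n ω))
  have hσ : ∀ n, IsProbabilityMeasure (σ n) := by
    intro n
    have := Measure.isProbabilityMeasure_map (μ := μ) (hZ n).aemeasurable
    have := Measure.isProbabilityMeasure_map (μ := μ) (hZ n).neg.aemeasurable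
    refine ⟨?_⟩
    have h1 : (μ.map (Z n)) Set.univ = 1 := measure_univ
    have h2 : (μ.map (fun ω => - Z n ω)) Set.univ = 1 := by
      have hm : Measurable (fun ω => - Z n ω) := (hZ n).neg
      rw [Measure.map_apply hm MeasurableSet.univ]; simp
    simp only [σ, Measure.smul_apply, Measure.add_apply, h1, h2, smul_eq_mul]
    rw [one_add_one_eq_two]
    exact ENNReal.inv_mul_cancel (by simp) (by simp)
  have hint : ∀ {E : Type} [NormedAddCommGroup E] [NormedSpace ℝ E] (n : ℕ) (g : ℝ → E) (C : ℝ),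
      StronglyMeasurable g → (∀ x, ‖g x‖ ≤ C) →
      ∫ x, g x ∂(σ n) = (2⁻¹ : ℝ) • ∫ ω, (g (Z n ω) + g (- Z n ω)) ∂μ := by
    intro E _ _ n g C hg hb
    have := Measure.isProbabilityMeasure_map (μ := μ) (hZ n).aemeasurable
    have : IsProbabilityMeasure (μ.map (fun ω => - Z n ω)) :=
      Measure.isProbabilityMeasure_map (μ := μ) (hZ n).neg.aemeasurable
    have hm : Measurable (fun ω => - Z n ω) := (hZ n).neg
    simp only [σ]
    rw [integral_smul_measure, integral_add_measure
      (Integrable.of_bound hg.aestronglyMeasurable C (ae_of_all _ hb))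
      (Integrable.of_bound hg.aestronglyMeasurable C (ae_of_all _ hb)),
      integral_map (hZ n).aemeasurable hg.aestronglyMeasurable,
      integral_map hm.aemeasurable hg.aestronglyMeasurable, integral_add]
    · simp
    · exact Integrable.of_bound (hg.comp_measurable (hZ n)).aestronglyMeasurable C
        (ae_of_all _ fun _ => hb _)
    · exact Integrable.of_bound (hg.comp_measurable hm).aestronglyMeasurable C
        (ae_of_all _ fun _ => hb _)
  let S : ℕ → ProbabilityMeasure ℝ := fun n => ⟨σ n, hσ n⟩
  let G : ProbabilityMeasure ℝ := ⟨gaussianReal 0 1, inferInstance⟩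
  have hS : ∀ n, (S n : Measure ℝ) = σ n := fun _ => rfl
  have hG : (G : Measure ℝ) = gaussianReal 0 1 := rfl
  have hconv : Tendsto S atTop (𝓝 G) := by
    refine ProbabilityMeasure.tendsto_of_tendsto_charFun fun t => ?_
    have hch : ∀ n, charFun (σ n) t = ((Real.cos (t / √n) ^ n : ℝ) : ℂ) := by
      intro n
      rw [charFun_apply_real, hint n (fun x : ℝ => Complex.exp (t * x * Complex.I)) 1
        (by fun_prop) (fun x => by
          rw [← Complex.ofReal_mul, Complex.norm_exp_ofReal_mul_I])]
      have : ∀ ω, Complex.exp (t * (Z n ω : ℝ) * Complex.I)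
          + Complex.exp (t * ((- Z n ω : ℝ) : ℂ) * Complex.I)
          = ((2 * Real.cos (t / √n * Y n ω) : ℝ) : ℂ) := by
        intro ω
        rw [show t / √n * Y n ω = t * Z n ω by simp only [Z]; ring]
        push_cast
        rw [Complex.two_cos]
        congr 2; ring
      simp_rw [this]
      rw [integral_complex_ofReal, integral_const_mul,
        skew_cos hα₀ hα₁ hmeas hstart hMarkov]
      simp
    simp only [hS, hG, hch, charFun_gaussianReal]
    have := (Complex.continuous_ofReal.tendsto _).comp (tendsto_cos_pow t)
    refine Eq.subst (motive := fun z => Tendsto (fun n : ℕ => ((Real.cos (t / √n) ^ n : ℝ) : ℂ)) atTop (𝓝 z)) ?_ this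
    rw [Complex.ofReal_exp]
    push_cast
    congr 1
    ring
  rw [ProbabilityMeasure.tendsto_iff_forall_integral_tendsto] at hconv
  let h : BoundedContinuousFunction ℝ ℝ := BoundedContinuousFunction.ofNormedAddCommGroup
    (fun x => α * f |x| + (1 - α) * f (-|x|)) (by fun_prop) ‖f‖ (by
      intro x
      have a1 := abs_le.1 (f.norm_coe_le_norm |x|)
      have a2 := abs_le.1 (f.norm_coe_le_norm (-|x|))
      rw [Real.norm_eq_abs, abs_le]
      constructor <;> nlinarith [a1.1, a1.2, a2.1, a2.2])
  have hfin := hconv h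
  simp only [hS, hG] at hfin
  have hlim : ∫ x, h x ∂(gaussianReal 0 1) = ∫ y : ℝ, f y * skewLimitDensity α y :=
    skew_limit_integral α f
  rw [hlim] at hfin
  refine hfin.congr fun n => ?_
  rw [hint n h ‖h‖ h.continuous.stronglyMeasurable h.norm_coe_le_norm]
  have hev : ∀ ω, h (Z n ω) + h (- Z n ω)
      = 2 * skewFold α (fun i : ℤ => f ((i : ℝ) / √n)) (Y n ω) := by
    intro ω
    have e : |Z n ω| = ((|Y n ω| : ℤ) : ℝ) / √n := by
      simp only [Z]; rw [abs_div, abs_of_nonneg (Real.sqrt_nonneg _)]; simp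
    have e' : ((-|Y n ω| : ℤ) : ℝ) / √n = - |Z n ω| := by
      rw [e]; push_cast; ring
    simp only [h, skewFold, BoundedContinuousFunction.coe_ofNormedAddCommGroup, abs_neg, e']
    rw [← e]; ring
  simp_rw [hev]
  rw [integral_const_mul, ← skew_fold hα₀ hα₁ hmeas hstart hMarkov n
    (fun i : ℤ => f ((i : ℝ) / √n)) ‖f‖ (fun i => f.norm_coe_le_norm _)]
  simp
end
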